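/- arXiv:1110.0309 — 11 statements merged into one kernel-verified Lean document; each statement's English description precedes it below -/
import Mathlib

section
/- Let G be a group, μ a finite subgroup of the center of G such that the quotient group G/μ is abelian, and suppose that the center Z of G has finite index in G. Let E be a field and χ : Z → Eˣ a group homomorphism whose restriction to μ is injective. Then the quotient algebra A_χ of the group algebra E[G] by the two-sided ideal generated by the elements z − χ(z)·1 for z ∈ Z is a central simple E-algebra, and its dimension over E equals the index [G : Z]. -/
/-- The relation on the group algebra `E[G]` identifying, for each `z` in the center `Z` of `G`,
the element `z` with the scalar `χ(z) · 1`.  The quotient `RingQuot` of `E[G]` by this relation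
is exactly the quotient of `E[G]` by the two-sided ideal generated by the elements
`z - χ(z) · 1` for `z ∈ Z`. -/
def centralCharRel (E : Type*) [Field E] (G : Type*) [Group G]
    (χ : Subgroup.center G →* Eˣ) :
    MonoidAlgebra E G → MonoidAlgebra E G → Prop := fun a b =>
  ∃ z : Subgroup.center G,
    a = MonoidAlgebra.of E G (z : G) ∧ b = algebraMap E (MonoidAlgebra E G) ((χ z : Eˣ) : E)

section TwistedGroupAlgebra

variable {G : Type*} [Group G] {E : Type*} [Field E] {A : Type*} [Ring A] [Algebra E A]
  {T : G →* A} {N : Subgroup G} {ω : G → G → E}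

/-- If `T h` conjugates `T g` to `ω h g • T g`, and every `g ∉ N` has some `ω h g ≠ 1`, then a
two-sided ideal containing an element with nonzero constant term and all other terms supported
outside `N` is the unit ideal. -/
lemma TwoSidedIdeal.one_mem_of_conj_eq_smul
    (hω : ∀ h g, T h * T g * T h⁻¹ = ω h g • T g)
    (hN : ∀ g, g ∉ N → ∃ h, ω h g ≠ 1) (I : TwoSidedIdeal A) {ι : Type*} (f : ι → G)
    (S : Finset ι) (hS : ∀ i ∈ S, f i ∉ N) (c₀ : E) (hc₀ : c₀ ≠ 0) (c : ι → E)
    (hI : c₀ • (1 : A) + ∑ i ∈ S, c i • T (f i) ∈ I) : 1 ∈ I := by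
  classical
  have smul_mem (e : E) {x : A} (hx : x ∈ I) : e • x ∈ I := by
    rw [Algebra.smul_def]
    exact I.mul_mem_left _ _ hx
  induction S using Finset.induction_on generalizing c₀ c with
  | empty => simpa [smul_smul, hc₀] using smul_mem c₀⁻¹ hI
  | insert j S hj ih =>
    obtain ⟨h, hh⟩ := hN (f j) (hS j (Finset.mem_insert_self j S))
    refine ih (fun i hi => hS i (Finset.mem_insert_of_mem hi)) (c₀ * (1 - ω h (f j)))
      (mul_ne_zero hc₀ (sub_ne_zero.2 hh.symm)) (fun i => c i * (ω h (f i) - ω h (f j))) ?_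
    have key := I.sub_mem (I.mul_mem_right _ (T h⁻¹) (I.mul_mem_left (T h) _ hI))
      (smul_mem (ω h (f j)) hI)
    convert key using 1
    have hT : T h * T h⁻¹ = 1 := by rw [← map_mul, mul_inv_cancel, map_one]
    rw [Finset.sum_insert hj]
    simp only [mul_add, add_mul, Finset.mul_sum, Finset.sum_mul, mul_smul_comm, smul_mul_assoc,
      hω, mul_one, hT, smul_add, Finset.smul_sum, smul_smul, mul_sub, sub_smul,
      Finset.sum_sub_distrib, mul_comm (ω h (f j))]
    abel

/-- A two-sided ideal containing a nonzero combination of the `T g`, for `g` running over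
representatives of the cosets of `N`, is the unit ideal. -/
lemma TwoSidedIdeal.one_mem_of_sum_out_mem [N.Normal]
    (hω : ∀ h g, T h * T g * T h⁻¹ = ω h g • T g)
    (hN : ∀ g, g ∉ N → ∃ h, ω h g ≠ 1) (I : TwoSidedIdeal A) (S : Finset (G ⧸ N))
    (c : G ⧸ N → E) (hI : ∑ q ∈ S, c q • T q.out ∈ I) (q₀ : G ⧸ N) (hq₀ : q₀ ∈ S)
    (hc : c q₀ ≠ 0) : 1 ∈ I := by
  classical
  refine I.one_mem_of_conj_eq_smul hω hN (fun q : G ⧸ N => q.out * q₀.out⁻¹) (S.erase q₀) ?_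
    (c q₀) hc c ?_
  · intro q hq hmem
    apply Finset.ne_of_mem_erase hq
    have := (QuotientGroup.eq_one_iff _).2 hmem
    rwa [QuotientGroup.mk_mul, QuotientGroup.mk_inv, QuotientGroup.out_eq',
      QuotientGroup.out_eq', mul_inv_eq_one] at this
  · have key := I.mul_mem_right _ (T q₀.out⁻¹) hI
    rw [← Finset.add_sum_erase _ _ hq₀] at key
    simpa only [add_mul, Finset.sum_mul, smul_mul_assoc, ← map_mul, mul_inv_cancel, map_one]
      using key

lemma linearIndependent_out_of_conj_eq_smul [Nontrivial A] [N.Normal]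
    (hω : ∀ h g, T h * T g * T h⁻¹ = ω h g • T g) (hN : ∀ g, g ∉ N → ∃ h, ω h g ≠ 1) :
    LinearIndependent E (fun q : G ⧸ N => T q.out) := by
  rw [linearIndependent_iff']
  intro S c hsum q hq
  by_contra hc
  exact one_ne_zero ((TwoSidedIdeal.mem_bot A).1 (TwoSidedIdeal.one_mem_of_sum_out_mem hω hN ⊥ S c
    ((TwoSidedIdeal.mem_bot A).2 hsum) q hq hc))

lemma isSimpleRing_of_conj_eq_smul [Nontrivial A] [N.Normal]
    (hω : ∀ h g, T h * T g * T h⁻¹ = ω h g • T g) (hN : ∀ g, g ∉ N → ∃ h, ω h g ≠ 1)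
    (b : Module.Basis (G ⧸ N) E A) (hb : ∀ q, b q = T q.out) : IsSimpleRing A := by
  refine ⟨⟨fun I => or_iff_not_imp_left.2 fun hI => ?_⟩⟩
  obtain ⟨a, ha, ha0⟩ : ∃ a ∈ I, a ≠ 0 := by
    by_contra! h
    exact hI (eq_bot_iff.2 fun x hx => (TwoSidedIdeal.mem_bot A).2 (h x hx))
  obtain ⟨q, hq⟩ : ∃ q, b.repr a q ≠ 0 := by
    by_contra! h
    exact ha0 (b.repr.map_eq_zero_iff.1 (Finsupp.ext h))
  rw [← b.linearCombination_repr a, Finsupp.linearCombination_apply, Finsupp.sum] at ha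
  simp only [hb] at ha
  exact (TwoSidedIdeal.one_mem_iff I).1
    (I.one_mem_of_sum_out_mem hω hN _ _ ha q (Finsupp.mem_support_iff.2 hq) hq)

lemma isCentral_of_conj_eq_smul [N.Normal]
    (hω : ∀ h g, T h * T g * T h⁻¹ = ω h g • T g) (hN : ∀ g, g ∉ N → ∃ h, ω h g ≠ 1)
    (hscalar : ∀ g ∈ N, ∃ e : E, T g = algebraMap E A e)
    (b : Module.Basis (G ⧸ N) E A) (hb : ∀ q, b q = T q.out) : Algebra.IsCentral E A := by
  refine ⟨fun a ha => ?_⟩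
  have hrepr := b.linearCombination_repr a
  rw [Finsupp.linearCombination_apply, Finsupp.sum] at hrepr
  have hconj (h : G) : T h * a * T h⁻¹ = a := by
    rw [Subalgebra.mem_center_iff.1 ha, mul_assoc, ← map_mul, mul_inv_cancel, map_one, mul_one]
  have hzero (q : G ⧸ N) (hq : q.out ∉ N) : b.repr a q = 0 := by
    obtain ⟨h, hh⟩ := hN _ hq
    by_contra hne
    have hsum : ∑ q ∈ (b.repr a).support, (b.repr a q * (ω h q.out - 1)) • b q = 0 := by
      have := sub_eq_zero.2 (hconj h)
      rw [← hrepr] at this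
      simpa only [hb, Finset.mul_sum, Finset.sum_mul, mul_smul_comm, smul_mul_assoc, hω, smul_smul,
        ← Finset.sum_sub_distrib, ← sub_smul, ← mul_sub_one] using this
    exact mul_ne_zero hne (sub_ne_zero.2 hh)
      (linearIndependent_iff'.1 b.linearIndependent _ _ hsum q (Finsupp.mem_support_iff.2 hne))
  rw [← hrepr]
  refine Subalgebra.sum_mem _ fun q _ => ?_
  by_cases hq : q.out ∈ N
  · obtain ⟨e, he⟩ := hscalar _ hq
    rw [hb, he]
    exact Subalgebra.smul_mem _ (Subalgebra.algebraMap_mem _ e) _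
  · rw [hzero q hq, zero_smul]
    exact Subalgebra.zero_mem _

end TwistedGroupAlgebra

section CentralCharQuotient

variable {G : Type*} [Group G] {E : Type*} [Field E] (χ : Subgroup.center G →* Eˣ)

/-- The functions `f : G → E` with `f (z * g) = χ z * f g` for all central `z`. -/
def centralCharFunctions : Submodule E (G → E) where
  carrier := {f | ∀ (z : Subgroup.center G) (g : G), f (z * g) = (χ z : E) * f g}
  add_mem' hf hf' z g := by simp only [Pi.add_apply, hf z g, hf' z g, mul_add]
  zero_mem' z g := by simp
  smul_mem' e f hf z g := by simp only [Pi.smul_apply, smul_eq_mul, hf z g, mul_left_comm]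

/-- The action of `G` on `centralCharFunctions χ` by right translation. -/
def centralCharRep : Representation E G (centralCharFunctions χ) where
  toFun g :=
    { toFun := fun f => ⟨fun x => f.1 (x * g), fun z x => by
        simpa only [mul_assoc] using f.2 z (x * g)⟩
      map_add' := fun _ _ => rfl
      map_smul' := fun _ _ => rfl }
  map_one' := by
    ext f x
    exact congrArg f.1 (mul_one x)
  map_mul' g h := by
    ext f x
    exact congrArg f.1 (mul_assoc x g h).symm

lemma centralCharRep_center (z : Subgroup.center G) :
    centralCharRep χ z = algebraMap E (Module.End E (centralCharFunctions χ)) (χ z : E) := by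
  ext f x
  exact (congrArg f.1 (Subgroup.mem_center_iff.1 z.2 x)).trans (f.2 z x)

instance nontrivial_centralCharFunctions : Nontrivial (centralCharFunctions χ) := by
  classical
  let f : G → E := fun g => if h : g ∈ Subgroup.center G then (χ ⟨g, h⟩ : E) else 0
  have hf : f ∈ centralCharFunctions χ := by
    intro z g
    by_cases h : g ∈ Subgroup.center G
    · have hzg : (z : G) * g ∈ Subgroup.center G := mul_mem z.2 h
      simp only [f, dif_pos h, dif_pos hzg]
      rw [← Units.val_mul, ← map_mul]
      rfl
    · have hzg : (z : G) * g ∉ Subgroup.center G := fun hm =>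
        h ((Subgroup.mul_mem_cancel_left _ z.2).1 hm)
      simp only [f, dif_neg h, dif_neg hzg, mul_zero]
  refine ⟨⟨f, hf⟩, 0, fun h => ?_⟩
  have h1 : f 1 = 0 := congrFun (congrArg Subtype.val h) 1
  simp only [f, dif_pos (one_mem (Subgroup.center G))] at h1
  exact (χ _).ne_zero h1

instance nontrivial_centralCharQuotient : Nontrivial (RingQuot (centralCharRel E G χ)) := by
  refine (RingQuot.liftAlgHom E (s := centralCharRel E G χ)
    ⟨MonoidAlgebra.lift E _ G (centralCharRep χ), ?_⟩).toRingHom.domain_nontrivial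
  rintro _ _ ⟨z, rfl, rfl⟩
  rw [MonoidAlgebra.lift_of, AlgHom.commutes]
  exact centralCharRep_center χ z

variable (E G) in
/-- The image of `G` in the quotient of `E[G]` by the central character `χ`. -/
noncomputable def centralCharOf : G →* RingQuot (centralCharRel E G χ) :=
  (RingQuot.mkAlgHom E (centralCharRel E G χ) : _ →* _).comp (MonoidAlgebra.of E G)

lemma centralCharOf_center (z : Subgroup.center G) :
    centralCharOf G E χ z = algebraMap E _ (χ z : E) :=
  (RingQuot.mkAlgHom_rel E ⟨z, rfl, rfl⟩).trans (AlgHom.commutes _ _)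

lemma span_centralCharOf_out :
    Submodule.span E
      (Set.range fun q : G ⧸ Subgroup.center G => centralCharOf G E χ q.out) = ⊤ := by
  rw [eq_top_iff]
  rintro a -
  obtain ⟨x, rfl⟩ := RingQuot.mkAlgHom_surjective E (centralCharRel E G χ) a
  induction x using MonoidAlgebra.induction_on with
  | of g =>
    obtain ⟨z, hz⟩ := QuotientGroup.mk_out_eq_mul (Subgroup.center G) g
    have hg : g = ((z⁻¹ : Subgroup.center G) : G) * (g : G ⧸ Subgroup.center G).out := by
      rw [hz, ← Subgroup.mem_center_iff.1 (z⁻¹).2, mul_assoc]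
      simp
    change centralCharOf G E χ g ∈ _
    rw [hg, map_mul, centralCharOf_center, ← Algebra.smul_def]
    exact Submodule.smul_mem _ _ (Submodule.subset_span ⟨_, rfl⟩)
  | add x y hx hy =>
    rw [map_add]
    exact Submodule.add_mem _ hx hy
  | smul e x hx =>
    rw [map_smul]
    exact Submodule.smul_mem _ _ hx

end CentralCharQuotient

open scoped commutatorElement

/-- Let `G` be a group, `μ` a finite subgroup of the center of `G` such that `G/μ` is abelian,
and suppose the center `Z` of `G` has finite index in `G`.  Let `E` be a field and
`χ : Z → Eˣ` a homomorphism whose restriction to `μ` is injective.  Then the quotient algebra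
`A_χ = E[G] / ⟨z - χ(z)·1 : z ∈ Z⟩` is a central simple `E`-algebra of dimension `[G : Z]`. -/
theorem centralCharQuotient_isCentralSimple
    {G : Type*} [Group G] (μ : Subgroup G) [Finite μ] [μ.Normal]
    (hμZ : μ ≤ Subgroup.center G)
    (hab : ∀ a b : G ⧸ μ, a * b = b * a)
    (hZ : (Subgroup.center G).FiniteIndex)
    (E : Type*) [Field E] (χ : Subgroup.center G →* Eˣ)
    (hχ : Function.Injective fun m : μ => χ ⟨(m : G), hμZ m.2⟩) :
    IsSimpleRing (RingQuot (centralCharRel E G χ)) ∧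
      Algebra.IsCentral E (RingQuot (centralCharRel E G χ)) ∧
      Module.finrank E (RingQuot (centralCharRel E G χ)) = (Subgroup.center G).index := by
  have hcomm (h g : G) : ⁅h, g⁆ ∈ μ := by
    rw [← QuotientGroup.eq_one_iff, ← QuotientGroup.mk'_apply, map_commutatorElement,
      commutatorElement_eq_one_iff_mul_comm]
    exact hab _ _
  let ω (h g : G) : E := (χ ⟨⁅h, g⁆, hμZ (hcomm h g)⟩ : Eˣ)
  have hω (h g : G) : centralCharOf G E χ h * centralCharOf G E χ g * centralCharOf G E χ h⁻¹ =
      ω h g • centralCharOf G E χ g := by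
    rw [Algebra.smul_def, ← centralCharOf_center]
    simp only [← map_mul, commutatorElement_def, inv_mul_cancel_right]
  have hN (g : G) (hg : g ∉ Subgroup.center G) : ∃ h, ω h g ≠ 1 := by
    by_contra! hone
    refine hg (Subgroup.mem_center_iff.2 fun h => commutatorElement_eq_one_iff_mul_comm.1 ?_)
    have hχ1 : χ ⟨⁅h, g⁆, hμZ (hcomm h g)⟩ = χ ⟨((1 : μ) : G), hμZ (1 : μ).2⟩ :=
      (Units.ext (hone h)).trans (map_one χ).symm
    exact congrArg Subtype.val (@hχ ⟨⁅h, g⁆, hcomm h g⟩ 1 hχ1)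
  let b := Module.Basis.mk (linearIndependent_out_of_conj_eq_smul hω hN)
    (span_centralCharOf_out χ).ge
  have hb (q : G ⧸ Subgroup.center G) : b q = centralCharOf G E χ q.out :=
    Module.Basis.mk_apply _ _ q
  exact ⟨isSimpleRing_of_conj_eq_smul hω hN b hb,
    isCentral_of_conj_eq_smul hω hN (fun g hg => ⟨_, centralCharOf_center χ ⟨g, hg⟩⟩) b hb,
    Module.finrank_eq_nat_card_basis b⟩
end

section
/- Let G be a group, μ a finite subgroup of the center of G such that the quotient group G/μ is abelian, and suppose that the center Z of G has finite index in G. Let E be a field, χ : Z → Eˣ a group homomorphism whose restriction to μ is injective, and V_χ an irreducible E[G]-module on which Z acts through χ. Then for any E[G]-module W, the space Hom_{E[G]}(V_χ, W) is nonzero if and only if there exists a nonzero vector w ∈ W satisfying z·w = χ(z)·w for all z ∈ Z. -/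
universe u v

/-- Nonzero joint eigenvectors of a family of endomorphisms, any two of which are separated by
some eigenvalue, are linearly independent. -/
theorem linearIndependent_of_separating_eigenvalues {E M ι κ : Type*} [Field E] [AddCommGroup M]
    [Module E M] (x : ι → M) (T : κ → Module.End E M) (ev : κ → ι → E)
    (hT : ∀ k i, T k (x i) = ev k i • x i) (hx : ∀ i, x i ≠ 0)
    (hsep : ∀ i j, (∀ k, ev k i = ev k j) → i = j) : LinearIndependent E x := by
  classical
  rw [linearIndependent_iff']
  intro s
  induction s using Finset.induction_on with
  | empty => simp
  | insert j s hj ih =>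
    intro c hc
    have hs : ∀ i ∈ s, c i = 0 := by
      intro i hi
      obtain ⟨k, hk⟩ : ∃ k, ev k i ≠ ev k j := by
        by_contra! h
        exact hj (hsep i j h ▸ hi)
      have hsum : ∑ i ∈ s, (c i * (ev k i - ev k j)) • x i = 0 := by
        rw [Finset.sum_insert hj] at hc
        have := congrArg (fun y => T k y - ev k j • y) hc
        simp only [map_add, map_sum, map_smul, hT, smul_add, Finset.smul_sum, map_zero, smul_zero,
          sub_zero] at this
        rw [smul_comm, add_sub_add_left_eq_sub, ← Finset.sum_sub_distrib] at this
        rw [← this]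
        refine Finset.sum_congr rfl fun i _ => ?_
        module
      exact (mul_eq_zero.mp (ih _ hsum i hi)).resolve_right (sub_ne_zero.mpr hk)
    rw [Finset.sum_insert hj, Finset.sum_eq_zero fun i hi => by rw [hs i hi, zero_smul],
      add_zero] at hc
    intro i hi
    rcases Finset.mem_insert.mp hi with rfl | hi
    · exact (smul_eq_zero.mp hc).resolve_right (hx i)
    · exact hs i hi

/-- If every scalar killing the finitely many vectors `v i` of a semisimple module also kills a
nonzero vector `w`, then `w` receives a nonzero homomorphism. -/
theorem exists_linearMap_ne_zero_of_forall_smul_eq_zero {R V W ι : Type*} [Ring R]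
    [AddCommGroup V] [Module R V] [IsSemisimpleModule R V] [AddCommGroup W] [Module R W]
    [Finite ι] (v : ι → V) {w : W} (hw : w ≠ 0)
    (h : ∀ a : R, (∀ i, a • v i = 0) → a • w = 0) : ∃ f : V →ₗ[R] W, f ≠ 0 := by
  classical
  let φ : R →ₗ[R] (ι → V) := LinearMap.toSpanSingleton R (ι → V) v
  have hker : LinearMap.ker φ ≤ LinearMap.ker (LinearMap.toSpanSingleton R W w) :=
    fun a ha => h a fun i => congrFun (LinearMap.mem_ker.mp ha) i
  obtain ⟨F, hF⟩ := IsSemisimpleModule.extension_property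
    ((LinearMap.ker φ).liftQ φ le_rfl)
    (LinearMap.ker_eq_bot.mp (Submodule.ker_liftQ_eq_bot _ _ _ le_rfl))
    ((LinearMap.ker φ).liftQ _ hker)
  have hFv : F v = w := by
    simpa [φ] using LinearMap.congr_fun hF (Submodule.Quotient.mk 1)
  by_contra! hzero
  have hF0 : F = 0 := LinearMap.pi_ext' fun i => by rw [hzero (F ∘ₗ _), LinearMap.zero_comp]
  exact hw (by rw [← hFv, hF0, LinearMap.zero_apply])

/-- The left ideal of `E[G]` generated by the elements `z - χ(z)` with `z` central. -/
noncomputable def centralCharIdeal {G E : Type*} [Group G] [Field E] (χ : Subgroup.center G →* Eˣ) :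
    Ideal (MonoidAlgebra E G) :=
  Ideal.span (Set.range fun z : Subgroup.center G =>
    MonoidAlgebra.of E G (z : G) - algebraMap E (MonoidAlgebra E G) ((χ z : Eˣ) : E))

theorem smul_eq_zero_of_mem_centralCharIdeal {G E W : Type*} [Group G] [Field E]
    {χ : Subgroup.center G →* Eˣ} [AddCommGroup W] [Module (MonoidAlgebra E G) W] {w : W}
    (hw : ∀ z : Subgroup.center G, MonoidAlgebra.of E G (z : G) • w =
      algebraMap E (MonoidAlgebra E G) ((χ z : Eˣ) : E) • w)
    {a : MonoidAlgebra E G} (ha : a ∈ centralCharIdeal χ) : a • w = 0 := by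
  have hle : centralCharIdeal χ ≤
      LinearMap.ker (LinearMap.toSpanSingleton (MonoidAlgebra E G) W w) := by
    refine Ideal.span_le.mpr ?_
    rintro _ ⟨z, rfl⟩
    simp only [SetLike.mem_coe, LinearMap.mem_ker, LinearMap.toSpanSingleton_apply]
    rw [sub_smul, hw, sub_self]
  exact hle ha

/-- Modulo `centralCharIdeal χ`, the group algebra is spanned by coset representatives of the
center. -/
theorem exists_sub_sum_mem_centralCharIdeal {G E : Type*} [Group G] [Field E]
    (χ : Subgroup.center G →* Eˣ) [Fintype (G ⧸ Subgroup.center G)] (a : MonoidAlgebra E G) :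
    ∃ c : G ⧸ Subgroup.center G → E,
      a - ∑ q, c q • MonoidAlgebra.of E G q.out ∈ centralCharIdeal χ := by
  classical
  induction a using MonoidAlgebra.induction_on with
  | of g =>
    obtain ⟨z, hz⟩ := QuotientGroup.mk_out_eq_mul (Subgroup.center G) g
    refine ⟨Pi.single (g : G ⧸ Subgroup.center G) ((χ z⁻¹ : Eˣ) : E), ?_⟩
    have hg : g = (g : G ⧸ Subgroup.center G).out * ((z⁻¹ : Subgroup.center G) : G) := by
      rw [hz]; simp
    rw [Finset.sum_eq_single (g : G ⧸ Subgroup.center G)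
      (fun q _ hq => by rw [Pi.single_eq_of_ne hq, zero_smul]) (by simp), Pi.single_eq_same]
    have hmem := Ideal.mul_mem_left (centralCharIdeal χ)
      (MonoidAlgebra.of E G (g : G ⧸ Subgroup.center G).out)
      (Ideal.subset_span (Set.mem_range_self z⁻¹))
    rwa [mul_sub, ← map_mul, ← hg, ← Algebra.commutes, ← Algebra.smul_def] at hmem
  | add a b ha hb =>
    obtain ⟨c, hc⟩ := ha
    obtain ⟨d, hd⟩ := hb
    refine ⟨c + d, ?_⟩
    convert add_mem hc hd using 1
    simp only [Pi.add_apply, add_smul, Finset.sum_add_distrib]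
    abel
  | smul e a ha =>
    obtain ⟨c, hc⟩ := ha
    refine ⟨e • c, ?_⟩
    convert Ideal.mul_mem_left _ (algebraMap E (MonoidAlgebra E G) e) hc using 1
    rw [← Algebra.smul_def, smul_sub, Finset.smul_sum]
    simp only [Pi.smul_apply, smul_assoc]

/-- In any nonzero algebra quotient on which the center acts through `χ`, coset representatives
of the center are linearly independent: conjugation acts on them by distinct characters. -/
theorem linearIndependent_quotient_out {G E A : Type*} [Group G] [Field E] [Ring A] [Algebra E A]
    [Nontrivial A] (μ : Subgroup G) [μ.Normal] (hμZ : μ ≤ Subgroup.center G)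
    (hab : ∀ a b : G ⧸ μ, a * b = b * a) (χ : Subgroup.center G →* Eˣ)
    (hχ : Function.Injective fun m : μ => χ ⟨(m : G), hμZ m.2⟩)
    (ρ : MonoidAlgebra E G →ₐ[E] A)
    (hρ : ∀ z : Subgroup.center G,
      ρ (MonoidAlgebra.of E G (z : G)) = algebraMap E A ((χ z : Eˣ) : E)) :
    LinearIndependent E fun q : G ⧸ Subgroup.center G => ρ (MonoidAlgebra.of E G q.out) := by
  have hcomm : ∀ h g : G, g⁻¹ * (h * g * h⁻¹) ∈ μ := by
    intro h g
    rw [← QuotientGroup.eq]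
    simp only [QuotientGroup.mk_mul, QuotientGroup.mk_inv]
    rw [hab h g, mul_inv_cancel_right]
  refine linearIndependent_of_separating_eigenvalues _
    (fun h : G => LinearMap.mulLeft E (ρ (MonoidAlgebra.of E G h)) ∘ₗ
      LinearMap.mulRight E (ρ (MonoidAlgebra.of E G h⁻¹)))
    (fun h q => ((χ ⟨_, hμZ (hcomm h q.out)⟩ : Eˣ) : E)) (fun h q => ?_) (fun q => ?_)
    (fun p q hpq => ?_)
  · have hconj : h * (q.out * h⁻¹) = q.out * (q.out⁻¹ * (h * q.out * h⁻¹)) := by group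
    rw [LinearMap.comp_apply, LinearMap.mulRight_apply, LinearMap.mulLeft_apply, ← map_mul,
      ← map_mul, ← map_mul, ← map_mul, hconj, map_mul, map_mul,
      hρ ⟨_, hμZ (hcomm h q.out)⟩, ← Algebra.commutes, ← Algebra.smul_def]
  · exact (((Group.isUnit q.out).map (MonoidAlgebra.of E G)).map ρ).ne_zero
  · rw [← QuotientGroup.out_eq' p, ← QuotientGroup.out_eq' q, QuotientGroup.eq]
    have hcent : q.out * p.out⁻¹ ∈ Subgroup.center G := by
      rw [Subgroup.mem_center_iff]
      intro h
      have heq : p.out⁻¹ * (h * p.out * h⁻¹) = q.out⁻¹ * (h * q.out * h⁻¹) :=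
        congrArg Subtype.val (@hχ ⟨_, hcomm h p.out⟩ ⟨_, hcomm h q.out⟩ (Units.ext (hpq h)))
      calc h * (q.out * p.out⁻¹)
          = q.out * (q.out⁻¹ * (h * q.out * h⁻¹)) * h * p.out⁻¹ := by group
        _ = q.out * p.out⁻¹ * h := by rw [← heq]; group
    simpa [mul_assoc] using (inferInstance : (Subgroup.center G).Normal).conj_mem _ hcent p.out⁻¹

/-- Let `G` be a group, `μ` a finite subgroup of the center of `G` with `G/μ` abelian, and
suppose the center `Z` of `G` has finite index in `G`.  Let `E` be a field, `χ : Z → Eˣ` a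
homomorphism whose restriction to `μ` is injective, and `V_χ` an irreducible `E[G]`-module on
which `Z` acts through `χ`.  Then for any `E[G]`-module `W`, there is a nonzero
`E[G]`-homomorphism `V_χ → W` if and only if `W` contains a nonzero vector `w` with
`z • w = χ(z) • w` for all `z ∈ Z`. -/
theorem hom_from_simple_ne_zero_iff_exists_eigenvector
    {G : Type*} [Group G] (μ : Subgroup G) [Finite μ] [μ.Normal]
    (hμZ : μ ≤ Subgroup.center G)
    (hab : ∀ a b : G ⧸ μ, a * b = b * a)
    (hZ : (Subgroup.center G).FiniteIndex)
    (E : Type*) [Field E] (χ : Subgroup.center G →* Eˣ)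
    (hχ : Function.Injective fun m : μ => χ ⟨(m : G), hμZ m.2⟩)
    (Vχ : Type u) [AddCommGroup Vχ] [Module (MonoidAlgebra E G) Vχ]
    (hsimple : IsSimpleModule (MonoidAlgebra E G) Vχ)
    (hcentralChar : ∀ (z : Subgroup.center G) (v : Vχ),
      MonoidAlgebra.of E G (z : G) • v = algebraMap E (MonoidAlgebra E G) ((χ z : Eˣ) : E) • v)
    (W : Type v) [AddCommGroup W] [Module (MonoidAlgebra E G) W] :
    (∃ f : Vχ →ₗ[MonoidAlgebra E G] W, f ≠ 0) ↔
      ∃ w : W, w ≠ 0 ∧ ∀ z : Subgroup.center G,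
        MonoidAlgebra.of E G (z : G) • w =
          algebraMap E (MonoidAlgebra E G) ((χ z : Eˣ) : E) • w := by
  let _ : Module E Vχ := Module.compHom Vχ (algebraMap E (MonoidAlgebra E G))
  have : IsScalarTower E (MonoidAlgebra E G) Vχ := .of_algebraMap_smul fun _ _ => rfl
  have hcenter : ∀ z : Subgroup.center G,
      Algebra.lsmul E E Vχ (MonoidAlgebra.of E G (z : G)) = algebraMap E _ ((χ z : Eˣ) : E) := by
    intro z
    ext v
    exact hcentralChar z v
  have : Nontrivial Vχ := IsSimpleModule.nontrivial (MonoidAlgebra E G) Vχ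
  have hind := linearIndependent_quotient_out μ hμZ hab χ hχ (Algebra.lsmul E E Vχ) hcenter
  have := Fintype.ofFinite (G ⧸ Subgroup.center G)
  constructor
  · rintro ⟨f, hf⟩
    obtain ⟨v, hv⟩ := DFunLike.ne_iff.mp hf
    exact ⟨f v, hv, fun z => by rw [← map_smul, hcentralChar, map_smul]⟩
  · rintro ⟨w, hw, hwχ⟩
    obtain ⟨v₀, hv₀⟩ := exists_ne (0 : Vχ)
    refine exists_linearMap_ne_zero_of_forall_smul_eq_zero
      (fun q : G ⧸ Subgroup.center G => MonoidAlgebra.of E G q.out • v₀) hw fun a ha => ?_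
    have haV : ∀ v : Vχ, a • v = 0 := by
      intro v
      obtain ⟨r, rfl⟩ := IsSimpleModule.toSpanSingleton_surjective (MonoidAlgebra E G) hv₀ v
      obtain ⟨c, hc⟩ := exists_sub_sum_mem_centralCharIdeal χ r
      have hr := smul_eq_zero_of_mem_centralCharIdeal (fun z => hcentralChar z v₀) hc
      rw [sub_smul, sub_eq_zero] at hr
      rw [LinearMap.toSpanSingleton_apply, hr, Finset.sum_smul, Finset.smul_sum]
      refine Finset.sum_eq_zero fun q _ => ?_
      rw [smul_assoc, smul_comm, ha q, smul_zero]
    obtain ⟨c, hc⟩ := exists_sub_sum_mem_centralCharIdeal χ a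
    have hc0 : c = 0 := by
      refine funext (Fintype.linearIndependent_iff.mp hind c ?_)
      ext v
      have hv := smul_eq_zero_of_mem_centralCharIdeal (fun z => hcentralChar z v) hc
      rw [sub_smul, haV, zero_sub, neg_eq_zero] at hv
      simpa [← map_smul, ← map_sum] using hv
    have haw := smul_eq_zero_of_mem_centralCharIdeal hwχ hc
    simpa [hc0] using haw
end

section
/- Let G be a group, μ a finite subgroup of the center of G such that the quotient group G/μ is abelian, and suppose that the center Z of G has finite index in G. Let E be a field and ε : μ → Eˣ an injective group homomorphism. Let A be a maximal abelian subgroup of G (so Z ⊆ A and A is normal in G), let χ : Z → Eˣ be a homomorphism with χ restricted to μ equal to ε, and let ψ : A → Eˣ be a homomorphism with ψ restricted to Z equal to χ. For t ∈ G, the map ψ_t : A → Eˣ defined by ψ_t(a) = ψ(t⁻¹ a t) is a well-defined group homomorphism whose restriction to Z equals χ, and the assignment t ↦ ψ_t induces a bijection from the coset space G/A onto the set of all group homomorphisms A → Eˣ whose restriction to Z equals χ. -/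
/-- A finite group has at most as many linear characters as elements. -/
theorem card_monoidHom_units_le (M E : Type*) [Group M] [Finite M] [Field E] :
    Nat.card (M →* Eˣ) ≤ Nat.card M := by
  have := Fintype.ofFinite M
  have hinj : Function.Injective (fun f : M →* Eˣ => (Units.coeHom E).comp f) := fun f g h =>
    MonoidHom.ext fun x => Units.ext (DFunLike.congr_fun h x)
  have hli := (linearIndependent_monoidHom M E).comp _ hinj
  have := Fintype.ofFinite (M →* Eˣ)
  simpa [Nat.card_eq_fintype_card] using hli.fintype_card_le_finrank

/-- A group of linear characters of a finite group that separates points contains every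
linear character. -/
theorem subgroup_monoidHom_units_eq_top {B E : Type*} [Group B] [Finite B] [Field E]
    (H : Subgroup (B →* Eˣ)) (hsep : ∀ b : B, (∀ f ∈ H, f b = 1) → b = 1) : H = ⊤ := by
  have hinj : Function.Injective H.subtype.flip := by
    rw [injective_iff_map_eq_one]
    exact fun b hb => hsep b fun f hf => DFunLike.congr_fun hb ⟨f, hf⟩
  apply Subgroup.eq_top_of_le_card
  exact (card_monoidHom_units_le B E).trans
    ((Nat.card_le_card_of_injective _ hinj).trans (card_monoidHom_units_le H E))

/-- For a pairing whose right kernel has finite index, every character trivial on the right kernel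
is given by pairing with an element on the left. -/
theorem mem_range_of_flip_ker_le_ker {P Q E : Type*} [Group P] [Group Q] [Field E]
    (f : P →* Q →* Eˣ) [f.flip.ker.FiniteIndex] (φ : Q →* Eˣ) (hφ : f.flip.ker ≤ φ.ker) :
    φ ∈ f.range := by
  have htop := subgroup_monoidHom_units_eq_top (QuotientGroup.kerLift f.flip).flip.range
    fun b hb => QuotientGroup.kerLift_injective f.flip <| by
      rw [map_one]
      exact MonoidHom.ext fun p => hb _ ⟨p, rfl⟩
  obtain ⟨p, hp⟩ : QuotientGroup.lift f.flip.ker φ hφ ∈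
      (QuotientGroup.kerLift f.flip).flip.range := htop ▸ Subgroup.mem_top _
  exact ⟨p, MonoidHom.ext fun q => DFunLike.congr_fun hp (q : Q ⧸ f.flip.ker)⟩

/-- A maximal abelian subgroup contains every element commuting with all of it. -/
theorem mem_of_maximal_abelian {G : Type*} [Group G] {A : Subgroup G}
    (hAcomm : ∀ a ∈ A, ∀ b ∈ A, a * b = b * a)
    (hAmax : ∀ B : Subgroup G, (∀ a ∈ B, ∀ b ∈ B, a * b = b * a) → A ≤ B → B = A)
    {t : G} (ht : ∀ a ∈ A, a * t = t * a) : t ∈ A := by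
  have hcomm : ∀ x ∈ insert t (A : Set G), ∀ y ∈ insert t (A : Set G), x * y = y * x := by
    rintro x (rfl | hx) y (rfl | hy)
    · rfl
    · exact (ht y hy).symm
    · exact ht x hx
    · exact hAcomm x hx y hy
  have := Subgroup.isMulCommutative_closure hcomm
  rw [← hAmax (Subgroup.closure (insert t (A : Set G))) (fun _ hx _ hy => setLike_mul_comm hx hy)
    fun _ hx => Subgroup.subset_closure (Set.mem_insert_of_mem t hx)]
  exact Subgroup.subset_closure (Set.mem_insert t _)

/-- Let `G` be a group, `μ` a finite subgroup of the center of `G` with `G/μ` abelian, and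
suppose the center `Z` of `G` has finite index in `G`.  Let `E` be a field, `ε : μ → Eˣ`
injective, `A` a maximal abelian subgroup of `G` (so `Z ⊆ A` and `A` is normal in `G`),
`χ : Z → Eˣ` extending `ε`, and `ψ : A → Eˣ` extending `χ`.  Then for each `t ∈ G` the map
`ψ_t : a ↦ ψ(t⁻¹ a t)` is a well-defined homomorphism `A → Eˣ` restricting to `χ` on `Z`, and
`t ↦ ψ_t` induces a bijection from `G/A` onto the set of homomorphisms `A → Eˣ` whose
restriction to `Z` is `χ`. -/
theorem conjugate_extensions_torsor
    {G : Type*} [Group G] (μ : Subgroup G) [Finite μ] [μ.Normal]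
    (hμZ : μ ≤ Subgroup.center G)
    (hab : ∀ a b : G ⧸ μ, a * b = b * a)
    (hZ : (Subgroup.center G).FiniteIndex)
    (E : Type*) [Field E] (ε : μ →* Eˣ) (hε : Function.Injective ε)
    (A : Subgroup G)
    (hAcomm : ∀ a ∈ A, ∀ b ∈ A, a * b = b * a)
    (hAmax : ∀ B : Subgroup G, (∀ a ∈ B, ∀ b ∈ B, a * b = b * a) → A ≤ B → B = A)
    (hZA : Subgroup.center G ≤ A)
    (χ : Subgroup.center G →* Eˣ)
    (hχε : ∀ m : μ, χ ⟨(m : G), hμZ m.2⟩ = ε m)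
    (ψ : A →* Eˣ)
    (hψχ : ∀ z : Subgroup.center G, ψ ⟨(z : G), hZA z.2⟩ = χ z) :
    -- conjugation by any `t ∈ G` preserves `A` (i.e. `A` is normal in `G`), ...
    ∃ hconj : ∀ (t : G) (a : A), t⁻¹ * (a : G) * t ∈ A,
      -- ... each `ψ_t` is a group homomorphism `A → Eˣ`, ...
      (∀ (t : G) (a b : A),
          ψ ⟨t⁻¹ * ((a * b : A) : G) * t, hconj t (a * b)⟩ =
            ψ ⟨t⁻¹ * (a : G) * t, hconj t a⟩ * ψ ⟨t⁻¹ * (b : G) * t, hconj t b⟩) ∧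
      -- ... whose restriction to the center is `χ`, ...
      (∀ (t : G) (z : Subgroup.center G),
          ψ ⟨t⁻¹ * (z : G) * t, hconj t ⟨(z : G), hZA z.2⟩⟩ = χ z) ∧
      -- ... `ψ_t = ψ_u` precisely when `t` and `u` lie in the same coset of `A`, ...
      (∀ t u : G,
          (∀ a : A, ψ ⟨t⁻¹ * (a : G) * t, hconj t a⟩ = ψ ⟨u⁻¹ * (a : G) * u, hconj u a⟩) ↔
            t⁻¹ * u ∈ A) ∧
      -- ... and every homomorphism `A → Eˣ` restricting to `χ` on `Z` is some `ψ_t`.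
      (∀ φ : A →* Eˣ, (∀ z : Subgroup.center G, φ ⟨(z : G), hZA z.2⟩ = χ z) →
          ∃ t : G, ∀ a : A, ψ ⟨t⁻¹ * (a : G) * t, hconj t a⟩ = φ a) := by
  have hm (t a : G) : t⁻¹ * a * t * a⁻¹ ∈ μ := by
    rw [← QuotientGroup.eq_one_iff]
    change (t : G ⧸ μ)⁻¹ * a * t * (a : G ⧸ μ)⁻¹ = 1
    rw [hab (t : G ⧸ μ)⁻¹ a]
    group
  have hconj (t : G) (a : A) : t⁻¹ * (a : G) * t ∈ A := by
    simpa using A.mul_mem (hZA (hμZ (hm t a))) a.2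
  have hmul (t : G) (a b : A) : ψ ⟨t⁻¹ * ((a * b : A) : G) * t, hconj t (a * b)⟩ =
      ψ ⟨t⁻¹ * (a : G) * t, hconj t a⟩ * ψ ⟨t⁻¹ * (b : G) * t, hconj t b⟩ := by
    rw [← map_mul]
    congr 1
    ext
    simp [mul_assoc]
  have hdecomp (t : G) (a : A) : ψ ⟨t⁻¹ * (a : G) * t, hconj t a⟩ =
      ε ⟨_, hm t a⟩ * ψ a := by
    rw [← hχε, ← hψχ, ← map_mul]
    congr 1
    ext
    simp
  let f : G →* A →* Eˣ := MonoidHom.mk' (fun t => MonoidHom.mk' (fun a => ε ⟨_, hm t a⟩)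
      fun a b => by
        have h := hmul t a b
        rw [hdecomp, hdecomp, hdecomp, map_mul, mul_mul_mul_comm] at h
        exact mul_right_cancel h)
    fun t u => MonoidHom.ext fun a => by
      change ε ⟨_, hm (t * u) a⟩ = ε ⟨_, hm t a⟩ * ε ⟨_, hm u a⟩
      rw [← map_mul]
      congr 1
      ext
      have hc := Subgroup.mem_center_iff.1 (hμZ (hm t a)) u⁻¹
      simp only [Subgroup.coe_mul]
      calc (t * u)⁻¹ * (a : G) * (t * u) * (a : G)⁻¹
          = u⁻¹ * (t⁻¹ * a * t * (a : G)⁻¹) * (a * u * (a : G)⁻¹) := by group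
        _ = _ := by rw [hc]; group
  have hf (t : G) (a : A) : f t a = ε ⟨_, hm t a⟩ := rfl
  have hf_one (t : G) (a : A) : f t a = 1 ↔ (a : G) * t = t * a := by
    rw [hf, map_eq_one_iff ε hε, Subtype.ext_iff, Subgroup.coe_one, mul_inv_eq_one, mul_assoc,
      inv_mul_eq_iff_eq_mul]
  refine ⟨hconj, hmul, fun t z => ?_, fun t u => ?_, fun φ hφ => ?_⟩
  · rw [← hψχ]
    congr 1
    ext
    simp [mul_assoc, ← Subgroup.mem_center_iff.1 z.2 t]
  · simp only [hdecomp, mul_left_inj, ← hf]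
    have h (a : A) : f t a = f u a ↔ (a : G) * (t⁻¹ * u) = t⁻¹ * u * a := by
      rw [← hf_one, map_mul, map_inv, MonoidHom.mul_apply, MonoidHom.inv_apply,
        inv_mul_eq_one]
    simp only [h]
    exact ⟨fun h => mem_of_maximal_abelian hAcomm hAmax fun a ha => h ⟨a, ha⟩,
      fun h a => hAcomm _ a.2 _ h⟩
  · have hker (a : A) : a ∈ f.flip.ker ↔ (a : G) ∈ Subgroup.center G := by
      rw [MonoidHom.mem_ker, Subgroup.mem_center_iff]
      exact ⟨fun h t => ((hf_one t a).1 (DFunLike.congr_fun h t)).symm,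
        fun h => MonoidHom.ext fun t => (hf_one t a).2 (h t).symm⟩
    have hle : (Subgroup.center G).subgroupOf A ≤ f.flip.ker := fun a ha => (hker a).2 ha
    have : f.flip.ker.FiniteIndex := Subgroup.finiteIndex_of_le hle
    obtain ⟨t, ht⟩ := mem_range_of_flip_ker_le_ker f (φ / ψ) fun a ha => by
      rw [MonoidHom.mem_ker, MonoidHom.div_apply, div_eq_one]
      have hz := (hker a).1 ha
      exact (hφ ⟨a, hz⟩).trans (hψχ ⟨a, hz⟩).symm
    refine ⟨t, fun a => ?_⟩
    rw [hdecomp, ← hf, ht, MonoidHom.div_apply, div_mul_cancel]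
end

section
/- Let G be a group and μ a finite cyclic subgroup of the center of G such that the quotient group G/μ is abelian, and suppose that the center Z of G has finite index in G. Then the index [G : Z] is a perfect square. -/
/-- A finite abelian group carrying a nondegenerate alternating pairing with values in `ℂˣ` has
square order: a maximal isotropic subgroup is its own orthogonal complement. -/
theorem natCard_isSquare_of_alternating_pairing {A : Type*} [CommGroup A] [Finite A]
    (b : A →* A →* ℂˣ) (halt : ∀ a, b a a = 1) (hb : ∀ a, (∀ c, b a c = 1) → a = 1) :
    IsSquare (Nat.card A) := by
  have hswap (x y : A) (h : b x y = 1) : b y x = 1 := by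
    have hxy := halt (x * y)
    simpa [halt, h] using hxy
  obtain ⟨L, hL⟩ := (Set.toFinite {L : Subgroup A | ∀ x ∈ L, ∀ y ∈ L, b x y = 1}).exists_maximal
    ⟨⊥, by simp⟩
  have hiso : ∀ x ∈ L, ∀ y ∈ L, b x y = 1 := hL.prop
  have hperp (a : A) (ha : ∀ l ∈ L, b a l = 1) : a ∈ L := by
    have hmem : L ⊔ Subgroup.zpowers a ∈
        {L : Subgroup A | ∀ x ∈ L, ∀ y ∈ L, b x y = 1} := by
      intro x hx y hy
      obtain ⟨l, hl, _, ⟨i, rfl⟩, rfl⟩ := Subgroup.mem_sup.mp hx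
      obtain ⟨m, hm, _, ⟨j, rfl⟩, rfl⟩ := Subgroup.mem_sup.mp hy
      simp [hiso l hl m hm, ha m hm, hswap a l (ha l hl), halt]
    exact hL.le_of_ge hmem le_sup_left
      (Subgroup.mem_sup_right (Subgroup.mem_zpowers a))
  let res : A →* L →* ℂˣ := (MonoidHom.domRestrictHom L ℂˣ).comp b
  have hker : res.ker = L := by
    ext a
    rw [MonoidHom.mem_ker, DFunLike.ext_iff]
    exact ⟨fun h => hperp a fun l hl => h ⟨l, hl⟩, fun ha l => hiso a ha l l.2⟩
  have card_hom (B : Type _) [CommGroup B] [Finite B] : Nat.card (B →* ℂˣ) = Nat.card B :=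
    CommGroup.card_monoidHom_of_hasEnoughRootsOfUnity B ℂ
  have hfin (B : Type _) [CommGroup B] [Finite B] : Finite (B →* ℂˣ) :=
    Nat.finite_of_card_ne_zero (by rw [card_hom]; exact Nat.card_pos.ne')
  have hle : Nat.card (A ⧸ L) ≤ Nat.card L := by
    have hindex : Nat.card (A ⧸ L) = Nat.card res.range := by
      rw [← Subgroup.index_ker, hker, Subgroup.index_eq_card]
    rw [← card_hom L, hindex]
    have := hfin L
    exact Nat.card_le_card_of_injective _ Subtype.val_injective
  have hge : Nat.card L ≤ Nat.card (A ⧸ L) := by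
    rw [← card_hom (A ⧸ L)]
    have := hfin (A ⧸ L)
    refine Nat.card_le_card_of_injective
      (fun l : L => QuotientGroup.lift L (b l) fun x hx => hiso l l.2 x hx) fun l m hlm => ?_
    have h (c : A) : b l c = b m c := DFunLike.congr_fun hlm (c : A ⧸ L)
    exact Subtype.ext (div_eq_one.mp (hb _ fun c => by simp [h c]))
  exact ⟨Nat.card L, by rw [L.card_eq_card_quotient_mul_card_subgroup, le_antisymm hle hge]⟩

/-- A finite cyclic group embeds into `ℂˣ`. -/
theorem exists_injective_monoidHom_complex_units (C : Type*) [Group C] [Finite C] [IsCyclic C] :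
    ∃ χ : C →* ℂˣ, Function.Injective χ := by
  have : NeZero (Nat.card C) := ⟨Nat.card_pos.ne'⟩
  let e : C ≃* rootsOfUnity (Nat.card C) ℂ :=
    mulEquivOfCyclicCardEq (HasEnoughRootsOfUnity.natCard_rootsOfUnity ℂ (Nat.card C)).symm
  exact ⟨(Subgroup.subtype _).comp e.toMonoidHom, Subtype.val_injective.comp e.injective⟩

open scoped commutatorElement

/-- If the commutators lie in a finite cyclic central subgroup, then the commutator map becomes a
bimultiplicative pairing with values in `ℂˣ`. -/
theorem exists_commutator_pairing {G : Type*} [Group G] (μ : Subgroup G) [Finite μ] [IsCyclic μ]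
    (hμZ : μ ≤ Subgroup.center G) (hcomm : ∀ g h : G, ⁅g, h⁆ ∈ μ) :
    ∃ b : G →* G →* ℂˣ, ∀ g h, b g h = 1 ↔ g * h = h * g := by
  obtain ⟨χ, hχ⟩ := exists_injective_monoidHom_complex_units μ
  have hcen (g h k : G) : k * ⁅g, h⁆ = ⁅g, h⁆ * k := Subgroup.mem_center_iff.mp (hμZ (hcomm g h)) k
  have hleft (g g' h : G) : ⁅g * g', h⁆ = ⁅g, h⁆ * ⁅g', h⁆ := by
    calc ⁅g * g', h⁆ = g * ⁅g', h⁆ * g⁻¹ * ⁅g, h⁆ := by simp only [commutatorElement_def]; group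
      _ = ⁅g, h⁆ * ⁅g', h⁆ := by rw [hcen g', mul_inv_cancel_right, hcen]
  have hright (g h h' : G) : ⁅g, h * h'⁆ = ⁅g, h⁆ * ⁅g, h'⁆ := by
    rw [← commutatorElement_inv, hleft, mul_inv_rev, commutatorElement_inv,
      commutatorElement_inv, hcen]
  refine ⟨MonoidHom.mk' (fun g => MonoidHom.mk' (fun h => χ ⟨⁅g, h⁆, hcomm g h⟩) fun h h' => ?_)
    fun g g' => MonoidHom.ext fun h => ?_, fun g h => ?_⟩
  · rw [← map_mul]
    exact congrArg χ (Subtype.ext (hright g h h'))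
  · simp only [MonoidHom.mk'_apply, MonoidHom.mul_apply]
    rw [← map_mul]
    exact congrArg χ (Subtype.ext (hleft g g' h))
  · simp only [MonoidHom.mk'_apply]
    rw [map_eq_one_iff χ hχ, Subgroup.mk_eq_one, commutatorElement_eq_one_iff_mul_comm]

/-- Let `G` be a group and `μ` a finite cyclic subgroup of the center of `G` such that `G/μ`
is abelian, and suppose the center `Z` of `G` has finite index in `G`.  Then the index
`[G : Z]` is a perfect square. -/
theorem index_center_isSquare
    {G : Type*} [Group G] (μ : Subgroup G) [Finite μ] [IsCyclic μ] [μ.Normal]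
    (hμZ : μ ≤ Subgroup.center G)
    (hab : ∀ a b : G ⧸ μ, a * b = b * a)
    (hZ : (Subgroup.center G).FiniteIndex) :
    ∃ d : ℕ, (Subgroup.center G).index = d * d := by
  have hcomm (g h : G) : ⁅g, h⁆ ∈ μ := by
    rw [← QuotientGroup.eq_one_iff]
    exact commutatorElement_eq_one_iff_mul_comm.mpr (hab g h)
  obtain ⟨b, hb⟩ := exists_commutator_pairing μ hμZ hcomm
  let instCommGroup : CommGroup (G ⧸ Subgroup.center G) :=
    { (inferInstance : Group (G ⧸ Subgroup.center G)) with
      mul_comm := by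
        rintro ⟨g⟩ ⟨h⟩
        refine commutatorElement_eq_one_iff_mul_comm.mp ?_
        exact (QuotientGroup.eq_one_iff ⁅g, h⁆).mpr (hμZ (hcomm g h)) }
  let c (g : G) : G ⧸ Subgroup.center G →* ℂˣ :=
    QuotientGroup.lift _ (b g) fun z hz => (hb g z).mpr (Subgroup.mem_center_iff.mp hz g)
  let pairing : G ⧸ Subgroup.center G →* G ⧸ Subgroup.center G →* ℂˣ :=
    QuotientGroup.lift _
      (MonoidHom.mk' c fun g g' => MonoidHom.ext <| by
        rintro ⟨h⟩
        exact DFunLike.congr_fun (map_mul b g g') h)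
      fun z hz => MonoidHom.ext <| by
        rintro ⟨h⟩
        exact (hb z h).mpr (Subgroup.mem_center_iff.mp hz h).symm
  rw [Subgroup.index_eq_card]
  refine natCard_isSquare_of_alternating_pairing pairing ?_ ?_
  · rintro ⟨g⟩
    exact (hb g g).mpr rfl
  · rintro ⟨g⟩ hg
    refine (QuotientGroup.eq_one_iff g).mpr (Subgroup.mem_center_iff.mpr fun h => ?_)
    exact ((hb g h).mp (hg (h : G ⧸ Subgroup.center G))).symm
end

section
/- Let pr : G̃ → G be a central extension of a group G by a finite group μ. Let N be a subgroup of G that is divisible, i.e. for every n ∈ N and every positive integer k there exists x ∈ N with x^k = n. Then any two group homomorphisms τ₁, τ₂ : N → G̃ satisfying pr ∘ τ₁ = pr ∘ τ₂ = (inclusion of N into G) are equal. -/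
/-- Let `pr : G̃ → G` be a central extension of `G` by a finite group `μ = ker pr`, and let
`N` be a divisible subgroup of `G`.  Then any two homomorphic sections of `pr` over `N` are
equal. -/
theorem section_unique_of_divisible
    {Gt G : Type*} [Group Gt] [Group G] (pr : Gt →* G)
    (hsurj : Function.Surjective pr) (hker_fin : Finite pr.ker)
    (hker_cent : pr.ker ≤ Subgroup.center Gt)
    (N : Subgroup G)
    (hdiv : ∀ n ∈ N, ∀ k : ℕ, 0 < k → ∃ x ∈ N, x ^ k = n)
    (τ₁ τ₂ : N →* Gt)
    (hτ₁ : ∀ n : N, pr (τ₁ n) = (n : G))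
    (hτ₂ : ∀ n : N, pr (τ₂ n) = (n : G)) :
    τ₁ = τ₂ := by
  ext ⟨n, hn⟩
  obtain ⟨x, hx, rfl⟩ := hdiv n hn (Nat.card pr.ker) Nat.card_pos
  set y : N := ⟨x, hx⟩
  have hz : τ₁ y * (τ₂ y)⁻¹ ∈ pr.ker := by
    rw [MonoidHom.mem_ker, map_mul, map_inv, hτ₁, hτ₂, mul_inv_cancel]
  have hpow : (τ₁ y * (τ₂ y)⁻¹) ^ Nat.card pr.ker = 1 :=
    congrArg Subtype.val (pow_card_eq_one' (x := (⟨_, hz⟩ : pr.ker)))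
  have hcomm : Commute (τ₁ y * (τ₂ y)⁻¹) (τ₂ y) :=
    (Subgroup.mem_center_iff.mp (hker_cent hz) (τ₂ y)).symm
  change τ₁ (y ^ Nat.card pr.ker) = τ₂ (y ^ Nat.card pr.ker)
  rw [map_pow, map_pow, ← inv_mul_cancel_right (τ₁ y) (τ₂ y), hcomm.mul_pow, hpow, one_mul]
end

section
/- Let V be the additive group of a vector space over ℚ, and let pr : G̃ → V be a surjective group homomorphism from a group G̃ whose kernel is finite and contained in the center of G̃. Then pr admits a group-homomorphic section, i.e. there is a group homomorphism s : V → G̃ with pr ∘ s = id_V. -/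
/-- If `f` has finite central kernel of order `n`, then `x ^ n` depends only on `f x`. -/
theorem MonoidHom.pow_card_ker_eq_of_map_eq {G H : Type*} [Group G] [Group H] (f : G →* H)
    (hcent : f.ker ≤ Subgroup.center G) {a b : G} (h : f a = f b) :
    a ^ Nat.card f.ker = b ^ Nat.card f.ker := by
  have hk : a⁻¹ * b ∈ f.ker := by simp [MonoidHom.mem_ker, h]
  have hpow : (a⁻¹ * b) ^ Nat.card f.ker = 1 := by
    simpa using congrArg Subtype.val (pow_card_eq_one' (x := (⟨a⁻¹ * b, hk⟩ : f.ker)))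
  have hcomm : Commute a (a⁻¹ * b) := Subgroup.mem_center_iff.mp (hcent hk) a
  calc a ^ Nat.card f.ker = (a * (a⁻¹ * b)) ^ Nat.card f.ker := by
        rw [hcomm.mul_pow, hpow, mul_one]
    _ = b ^ Nat.card f.ker := by rw [mul_inv_cancel_left]

/-- If `f : G → A` has finite central kernel of order `n` and commutative target, then `n`-th powers
are central in `G`. -/
theorem MonoidHom.commute_pow_card_ker {G A : Type*} [Group G] [CommGroup A] (f : G →* A)
    (hcent : f.ker ≤ Subgroup.center G) (x y : G) : Commute y (x ^ Nat.card f.ker) := by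
  have h := f.pow_card_ker_eq_of_map_eq hcent (a := y * x * y⁻¹) (b := x) (by simp)
  rw [conj_pow] at h
  exact mul_inv_eq_iff_eq_mul.mp h

/-- Let `V` be the additive group of a `ℚ`-vector space and `pr : G̃ → V` a surjective group
homomorphism with finite kernel contained in the center of `G̃`.  Then `pr` admits a
group-homomorphic section. -/
theorem central_extension_of_rat_vector_space_splits
    {Gt : Type*} [Group Gt] {V : Type*} [AddCommGroup V] [Module ℚ V]
    (pr : Gt →* Multiplicative V)
    (hsurj : Function.Surjective pr) (hker_fin : Finite pr.ker)
    (hker_cent : pr.ker ≤ Subgroup.center Gt) :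
    ∃ s : Multiplicative V →* Gt, ∀ v : Multiplicative V, pr (s v) = v := by
  set n := Nat.card pr.ker with hn
  have hn0 : (n : ℚ) ≠ 0 := Nat.cast_ne_zero.mpr Nat.card_pos.ne'
  let root (v : Multiplicative V) : Multiplicative V :=
    Multiplicative.ofAdd ((n : ℚ)⁻¹ • v.toAdd)
  have root_mul (v w : Multiplicative V) : root (v * w) = root v * root w := by
    simp [root, smul_add]
  have root_pow (v : Multiplicative V) : root v ^ n = v := by
    apply Multiplicative.toAdd.injective
    simp [root, ← Nat.cast_smul_eq_nsmul ℚ, smul_smul, hn0]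
  choose lift hlift using hsurj
  have comm (x y : Gt) : Commute x y := by
    have hk : (lift (root (pr y)) ^ n)⁻¹ * y ∈ pr.ker := by
      simp [MonoidHom.mem_ker, hlift, root_pow]
    have hy := (pr.commute_pow_card_ker hker_cent (lift (root (pr y))) x).mul_right
      (Subgroup.mem_center_iff.mp (hker_cent hk) x)
    rwa [← hn, mul_inv_cancel_left] at hy
  refine ⟨MonoidHom.mk' (fun v => lift (root v) ^ n) fun v w => ?_, fun v => ?_⟩
  · rw [← (comm _ _).mul_pow]
    exact pr.pow_card_ker_eq_of_map_eq hker_cent (by simp [hlift, root_mul])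
  · simp [hlift, root_pow]
end

section
/- Let pr : Ñ → N be a central extension of a group N by a finite group μ. Suppose there is a finite chain of subgroups N = N₀ ⊇ N₁ ⊇ ⋯ ⊇ N_r = {1}, each N_i normal in N, such that for every i the quotient group N_i/N_{i+1} is contained in the center of N/N_{i+1} and is isomorphic, as a group, to the additive group of some ℚ-vector space. Then there exists exactly one group homomorphism s : N → Ñ with pr ∘ s = id_N. -/
/-- If `A / (A ∩ B)` is the additive group of a `ℚ`-vector space, then for `m ≠ 0` every element
of `A` is an `m`-th power modulo `B`, and `A / (A ∩ B)` has no `m`-torsion. -/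
theorem exists_pow_mod_and_torsionFree_of_quotient_mulEquiv {N V : Type*} [Group N]
    [AddCommGroup V] [Module ℚ V] {A B : Subgroup N} [(B.subgroupOf A).Normal]
    (e : (↥A ⧸ B.subgroupOf A) ≃* Multiplicative V) {m : ℕ} (hm : m ≠ 0) :
    (∀ x ∈ A, ∃ y ∈ A, (y ^ m)⁻¹ * x ∈ B) ∧ ∀ y ∈ A, y ^ m ∈ B → y ∈ B := by
  have hm' : (m : ℚ) ≠ 0 := Nat.cast_ne_zero.mpr hm
  constructor
  · intro x hx
    obtain ⟨⟨y, hyA⟩, hy⟩ := QuotientGroup.mk_surjective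
      (e.symm (Multiplicative.ofAdd ((m : ℚ)⁻¹ • (e (⟨x, hx⟩ : A)).toAdd)))
    refine ⟨y, hyA, ?_⟩
    have key : (((⟨y, hyA⟩ : A) ^ m : A) : ↥A ⧸ B.subgroupOf A) = ((⟨x, hx⟩ : A) : _) := by
      apply e.injective
      rw [QuotientGroup.mk_pow, map_pow, hy, e.apply_symm_apply, ← ofAdd_nsmul,
        ← Nat.cast_smul_eq_nsmul ℚ, smul_inv_smul₀ hm', ofAdd_toAdd]
    simpa [QuotientGroup.eq, Subgroup.mem_subgroupOf] using key
  · intro y hyA hy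
    have key : (((⟨y, hyA⟩ : A) ^ m : A) : ↥A ⧸ B.subgroupOf A) = 1 := by
      rw [QuotientGroup.eq_one_iff, Subgroup.mem_subgroupOf]
      exact hy
    have hpow : m • (e (⟨y, hyA⟩ : A)).toAdd = 0 := by
      rw [← toAdd_pow, ← map_pow, ← QuotientGroup.mk_pow, key, map_one, toAdd_one]
    rw [← Nat.cast_smul_eq_nsmul ℚ, smul_eq_zero_iff_right hm', toAdd_eq_zero,
      EmbeddingLike.map_eq_one_iff, QuotientGroup.eq_one_iff, Subgroup.mem_subgroupOf] at hpow
    exact hpow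

/-- A normal subgroup lifting `B` isomorphically through a central extension with kernel of
exponent `m` extends to one lifting `A`, provided that `A / B` is central, `m`-divisible and
without `m`-torsion. -/
theorem exists_normal_lift_of_central_divisible {Nt N : Type*} [Group Nt] [Group N]
    {pr : Nt →* N} (hsurj : Function.Surjective pr) (hcent : pr.ker ≤ Subgroup.center Nt)
    {m : ℕ} (hm : ∀ z ∈ pr.ker, z ^ m = 1) {A B : Subgroup N} [hA : A.Normal]
    (hAB : ∀ g : N, ∀ x ∈ A, g * x * g⁻¹ * x⁻¹ ∈ B)
    (hdiv : ∀ x ∈ A, ∃ y ∈ A, (y ^ m)⁻¹ * x ∈ B)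
    (htors : ∀ y ∈ A, y ^ m ∈ B → y ∈ B)
    {S : Subgroup Nt} [S.Normal] (hS : Disjoint S pr.ker) (hSB : S.map pr = B) :
    ∃ T : Subgroup Nt, T.Normal ∧ Disjoint T pr.ker ∧ T.map pr = A := by
  have hlift (x : Nt) (hx : pr x ∈ B) : ∃ z ∈ pr.ker, (x : Nt ⧸ S) = z := by
    rw [← hSB] at hx
    obtain ⟨t, ht, htx⟩ := hx
    refine ⟨t⁻¹ * x, by simp [MonoidHom.mem_ker, htx], ?_⟩
    rw [QuotientGroup.mk_mul, QuotientGroup.mk_inv, (QuotientGroup.eq_one_iff t).mpr ht, inv_one,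
      one_mul]
  have hcomm (z : Nt) (hz : z ∈ pr.ker) (x : Nt) : Commute (z : Nt ⧸ S) x := by
    have := Subgroup.mem_center_iff.mp (hcent hz) x
    exact congrArg (QuotientGroup.mk (s := S)) this.symm
  have hzpow (z : Nt) (hz : z ∈ pr.ker) : (z : Nt ⧸ S) ^ m = 1 := by
    rw [← QuotientGroup.mk_pow, hm z hz, QuotientGroup.mk_one]
  have hpow_comm (x y : Nt) (hy : pr y ∈ A) : Commute (x : Nt ⧸ S) ((y : Nt ⧸ S) ^ m) := by
    obtain ⟨z, hz, hxz⟩ := hlift (x * y * x⁻¹ * y⁻¹) (by simpa using hAB (pr x) (pr y) hy)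
    have hconj : (x : Nt ⧸ S) * y * (x : Nt ⧸ S)⁻¹ = z * y := by
      rw [← hxz]; simp
    have hconj_pow := congrArg (· ^ m) hconj
    simp only [conj_pow, (hcomm z hz y).mul_pow, hzpow z hz, one_mul] at hconj_pow
    exact mul_inv_eq_iff_eq_mul.mp hconj_pow
  have hcentral (x y : Nt) (hy : pr y ∈ A) : Commute (x : Nt ⧸ S) y := by
    obtain ⟨w, hwA, hw⟩ := hdiv _ hy
    obtain ⟨w, rfl⟩ := hsurj w
    obtain ⟨z, hz, hyz⟩ := hlift ((w ^ m)⁻¹ * y) (by simpa using hw)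
    have hy_eq : (y : Nt ⧸ S) = (w : Nt ⧸ S) ^ m * z := by
      rw [← hyz]; simp
    rw [hy_eq]
    exact (hpow_comm x w hwA).mul_right (hcomm z hz x).symm
  let T : Subgroup Nt :=
    { carrier := {x | pr x ∈ A ∧ ∃ y, pr y ∈ A ∧ (x : Nt ⧸ S) = (y : Nt ⧸ S) ^ m}
      one_mem' := ⟨by simp [A.one_mem], 1, by simp [A.one_mem], by simp⟩
      mul_mem' := by
        rintro a b ⟨ha, y, hy, hay⟩ ⟨hb, w, hw, hbw⟩
        refine ⟨by simpa using A.mul_mem ha hb, y * w, by simpa using A.mul_mem hy hw, ?_⟩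
        rw [QuotientGroup.mk_mul, QuotientGroup.mk_mul, (hcentral y w hw).mul_pow, hay, hbw]
      inv_mem' := by
        rintro a ⟨ha, y, hy, hay⟩
        refine ⟨by simpa using ha, y⁻¹, by simpa using hy, ?_⟩
        rw [QuotientGroup.mk_inv, QuotientGroup.mk_inv, hay, inv_pow] }
  refine ⟨T, ⟨?_⟩, ?_, ?_⟩
  · rintro x ⟨hx, y, hy, hxy⟩ g
    have hg : ((g * x * g⁻¹ : Nt) : Nt ⧸ S) = x := by
      rw [QuotientGroup.mk_mul, QuotientGroup.mk_mul, (hcentral g x hx).eq]; simp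
    exact ⟨by simpa using hA.conj_mem _ hx (pr g), y, hy, hg.trans hxy⟩
  · rw [Subgroup.disjoint_def]
    rintro x ⟨-, y, hy, hxy⟩ hx
    have hmem : (y ^ m)⁻¹ * x ∈ S := by
      rw [← QuotientGroup.eq, hxy, QuotientGroup.mk_pow]
    have hyB : pr y ∈ B := by
      apply htors _ hy
      have := Subgroup.mem_map_of_mem pr hmem
      rw [hSB, map_mul, MonoidHom.mem_ker.mp hx] at this
      simpa using this
    obtain ⟨z, hz, hyz⟩ := hlift y hyB
    rw [hyz, hzpow z hz, QuotientGroup.eq_one_iff] at hxy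
    exact Subgroup.disjoint_def.mp hS hxy hx
  · apply le_antisymm
    · rintro _ ⟨x, hx, rfl⟩
      exact hx.1
    · intro n hn
      obtain ⟨y, hyA, hy⟩ := hdiv n hn
      obtain ⟨y, rfl⟩ := hsurj y
      rw [← hSB] at hy
      obtain ⟨t, ht, hty⟩ := hy
      have hpr : pr (y ^ m * t) = n := by rw [map_mul, hty, map_pow, mul_inv_cancel_left]
      refine ⟨y ^ m * t, ⟨by rwa [hpr], y, hyA, ?_⟩, hpr⟩
      rw [QuotientGroup.mk_mul, (QuotientGroup.eq_one_iff t).mpr ht, mul_one,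
        QuotientGroup.mk_pow]

/-- A central extension with kernel of exponent `m` has at most one section when the base has a
finite filtration with `m`-divisible steps. -/
theorem section_unique_of_divisible_filtration {Nt N : Type*} [Group Nt] [Group N]
    {pr : Nt →* N} (hcent : pr.ker ≤ Subgroup.center Nt)
    {m : ℕ} (hm : ∀ z ∈ pr.ker, z ^ m = 1) {r : ℕ} {c : ℕ → Subgroup N}
    (hc0 : c 0 = ⊤) (hcr : c r = ⊥)
    (hdiv : ∀ i < r, ∀ x ∈ c i, ∃ y ∈ c i, (y ^ m)⁻¹ * x ∈ c (i + 1))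
    {s t : N →* Nt} (hs : ∀ n, pr (s n) = n) (ht : ∀ n, pr (t n) = n) : s = t := by
  have hpow (y : N) : s (y ^ m) = t (y ^ m) := by
    have hz : s y * (t y)⁻¹ ∈ pr.ker := by simp [MonoidHom.mem_ker, hs, ht]
    have hcomm : Commute (s y * (t y)⁻¹) (t y) :=
      (Subgroup.mem_center_iff.mp (hcent hz) (t y)).symm
    rw [map_pow, map_pow, ← inv_mul_cancel_right (s y) (t y), hcomm.mul_pow, hm _ hz, one_mul]
  have hagree : ∀ x ∈ c 0, s x = t x := by
    refine Nat.decreasingInduction (motive := fun i _ => ∀ x ∈ c i, s x = t x)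
      (fun i hi ih x hx => ?_) (fun x hx => ?_) (Nat.zero_le r)
    · obtain ⟨y, -, hy⟩ := hdiv i hi x hx
      rw [← mul_inv_cancel_left (y ^ m) x, map_mul s (y ^ m), map_mul t (y ^ m), ih _ hy, hpow]
    · rw [hcr, Subgroup.mem_bot] at hx
      rw [hx, map_one, map_one]
  exact MonoidHom.ext fun x => hagree x (hc0 ▸ Subgroup.mem_top x)

/-- Let `pr : Ñ → N` be a central extension of a group `N` by a finite group `μ = ker pr`.
Suppose there is a finite chain of subgroups `N = N₀ ⊇ N₁ ⊇ ⋯ ⊇ N_r = {1}`, each `N_i`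
normal in `N`, such that each quotient `N_i/N_{i+1}` is contained in the center of
`N/N_{i+1}` (i.e. all commutators of elements of `N` with elements of `N_i` lie in `N_{i+1}`)
and is isomorphic as a group to the additive group of some `ℚ`-vector space.  Then there is
exactly one group-homomorphic section of `pr`. -/
theorem existsUnique_section_of_unipotent_filtration
    {Nt N : Type*} [Group Nt] [Group N] (pr : Nt →* N)
    (hsurj : Function.Surjective pr) (hker_fin : Finite pr.ker)
    (hker_cent : pr.ker ≤ Subgroup.center Nt)
    (r : ℕ) (c : ℕ → Subgroup N)
    (hc0 : c 0 = ⊤) (hcr : c r = ⊥)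
    (hchain : ∀ i < r, c (i + 1) ≤ c i)
    (hnorm : ∀ i, (c i).Normal)
    (hcent : ∀ i < r, ∀ g : N, ∀ x ∈ c i, g * x * g⁻¹ * x⁻¹ ∈ c (i + 1))
    (hvec : ∀ i < r,
      letI : ((c (i + 1)).subgroupOf (c i)).Normal := (hnorm (i + 1)).subgroupOf (c i)
      ∃ (V : Type*) (_ : AddCommGroup V) (_ : Module ℚ V),
        Nonempty ((↥(c i) ⧸ (c (i + 1)).subgroupOf (c i)) ≃* Multiplicative V)) :
    ∃! s : N →* Nt, ∀ n : N, pr (s n) = n := by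
  have hm : Nat.card pr.ker ≠ 0 := Nat.card_pos.ne'
  have hkpow (z : Nt) (hz : z ∈ pr.ker) : z ^ Nat.card pr.ker = 1 :=
    congrArg Subtype.val (pow_card_eq_one' (x := (⟨z, hz⟩ : pr.ker)))
  have hgr (i : ℕ) (hi : i < r) :
      (∀ x ∈ c i, ∃ y ∈ c i, (y ^ Nat.card pr.ker)⁻¹ * x ∈ c (i + 1)) ∧
        ∀ y ∈ c i, y ^ Nat.card pr.ker ∈ c (i + 1) → y ∈ c (i + 1) := by
    obtain ⟨V, _, _, ⟨e⟩⟩ := hvec i hi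
    have : ((c (i + 1)).subgroupOf (c i)).Normal := (hnorm (i + 1)).subgroupOf (c i)
    exact exists_pow_mod_and_torsionFree_of_quotient_mulEquiv e hm
  obtain ⟨S, -, hS, hSmap⟩ : ∃ S : Subgroup Nt, S.Normal ∧ Disjoint S pr.ker ∧ S.map pr = ⊤ := by
    rw [← hc0]
    refine Nat.decreasingInduction
      (motive := fun i _ => ∃ S : Subgroup Nt, S.Normal ∧ Disjoint S pr.ker ∧ S.map pr = c i)
      (fun i hi ih => ?_) ⟨⊥, inferInstance, disjoint_bot_left, by simp [hcr]⟩ (Nat.zero_le r)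
    obtain ⟨S, hSn, hS, hSmap⟩ := ih
    have := hnorm i
    exact exists_normal_lift_of_central_divisible hsurj hker_cent hkpow (hcent i hi)
      (hgr i hi).1 (hgr i hi).2 hS hSmap
  have hbij : Function.Bijective (pr.comp S.subtype) := by
    constructor
    · rw [injective_iff_map_eq_one]
      exact fun x hx => Subtype.ext (Subgroup.disjoint_def.mp hS x.2 hx)
    · intro n
      obtain ⟨x, hx, hxn⟩ : n ∈ S.map pr := hSmap ▸ Subgroup.mem_top n
      exact ⟨⟨x, hx⟩, hxn⟩
  let e := MulEquiv.ofBijective _ hbij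
  have he (n : N) : pr ((S.subtype.comp e.symm.toMonoidHom) n) = n := e.apply_symm_apply n
  refine ⟨S.subtype.comp e.symm.toMonoidHom, he, fun s hs => ?_⟩
  exact section_unique_of_divisible_filtration hker_cent hkpow hc0 hcr
    (fun i hi => (hgr i hi).1) hs he
end

section
/- Let pr : G̃ → G be a central extension of a group G by a finite group μ. Let P be a subgroup of G with subgroups M, N ≤ P such that N is normal in P, M ∩ N = {1}, and M·N = P. Suppose N admits exactly one homomorphic section τ : N → G̃ of pr, and let N̂ = τ(N). Set P̃ = pr⁻¹(P) and M̃ = pr⁻¹(M). Then N̂ is a normal subgroup of P̃, M̃ ∩ N̂ = {1}, and M̃·N̂ = P̃; in other words P̃ is the internal semidirect product of M̃ and N̂. -/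
/-- Let `pr : G̃ → G` be a central extension of `G` by a finite group `μ = ker pr`.  Let
`P ≤ G` with subgroups `M, N ≤ P` such that `N` is normal in `P`, `M ∩ N = 1` and `M·N = P`.
Suppose `N` admits exactly one homomorphic section `τ` of `pr`, and let `N̂ = τ(N)`,
`P̃ = pr⁻¹(P)`, `M̃ = pr⁻¹(M)`.  Then `N̂` is normal in `P̃`, `M̃ ∩ N̂ = 1`, and
`M̃·N̂ = P̃`, i.e. `P̃` is the internal semidirect product of `M̃` and `N̂`. -/
theorem preimage_semidirect_product
    {Gt G : Type*} [Group Gt] [Group G] (pr : Gt →* G)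
    (hsurj : Function.Surjective pr) (hker_fin : Finite pr.ker)
    (hker_cent : pr.ker ≤ Subgroup.center Gt)
    (P M N : Subgroup G) (hMP : M ≤ P) (hNP : N ≤ P)
    (hNnormal : ∀ p ∈ P, ∀ n ∈ N, p * n * p⁻¹ ∈ N)
    (hMN : M ⊓ N = ⊥)
    (hprod : ∀ p ∈ P, ∃ m ∈ M, ∃ n ∈ N, p = m * n)
    (τ : N →* Gt)
    (hτ : ∀ n : N, pr (τ n) = (n : G))
    (huniq : ∀ τ' : N →* Gt, (∀ n : N, pr (τ' n) = (n : G)) → τ' = τ) :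
    -- `N̂ = τ(N)` is normal in `P̃ = pr⁻¹(P)`, ...
    (∀ p ∈ P.comap pr, ∀ n ∈ τ.range, p * n * p⁻¹ ∈ τ.range) ∧
      -- ... it meets `M̃ = pr⁻¹(M)` trivially, ...
      (M.comap pr ⊓ τ.range = ⊥) ∧
      -- ... and `M̃ · N̂ = P̃`.
      (∀ x ∈ P.comap pr, ∃ m ∈ M.comap pr, ∃ n ∈ τ.range, x = m * n) := by
  refine ⟨?_, ?_, ?_⟩
  · rintro p hp _ ⟨n, rfl⟩
    let c : N →* N := ((MulAut.conj (pr p)).toMonoidHom.comp N.subtype).codRestrict N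
      fun n => hNnormal (pr p) hp n n.2
    have hc : ∀ n : N, (c n : G) = pr p * n * (pr p)⁻¹ := fun _ => rfl
    -- Conjugating `τ` by `p` gives another section over `N`, hence `τ` itself.
    have h := huniq ((MulAut.conj p⁻¹).toMonoidHom.comp (τ.comp c)) fun n => by
      simp [hτ, hc, mul_assoc]
    refine ⟨c n, ?_⟩
    rw [← DFunLike.congr_fun h n]
    simp [mul_assoc]
  · rw [eq_bot_iff]
    rintro _ ⟨hx, n, rfl⟩
    have hn : (n : G) ∈ M ⊓ N := ⟨by simpa [hτ] using hx, n.2⟩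
    rw [hMN, Subgroup.mem_bot, OneMemClass.coe_eq_one] at hn
    simp [hn]
  · intro x hx
    obtain ⟨m, hm, n, hn, hmn⟩ := hprod (pr x) hx
    refine ⟨x * (τ ⟨n, hn⟩)⁻¹, ?_, τ ⟨n, hn⟩, ⟨_, rfl⟩, by simp⟩
    simpa [hτ, hmn] using hm
end

section
/- Let pr : G̃ → G be a central extension of a group G by a finite group μ. Let N be a subgroup of G admitting exactly one homomorphic section τ : N → G̃ of pr, let N₀ be a subgroup of N, and set N̂₀ = τ(N₀). Let g̃ ∈ G̃ and g = pr(g̃), and suppose that g normalizes N, i.e. g N g⁻¹ = N. Then g̃ N̂₀ g̃⁻¹ ⊆ N̂₀ if and only if g N₀ g⁻¹ ⊆ N₀. -/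
/-- A unique homomorphic section `τ` of `pr` over `N` intertwines conjugation by `pr gt` with
conjugation by `gt`, whenever `pr gt` conjugates `N` into itself. -/
theorem unique_section_conj {Gt G : Type*} [Group Gt] [Group G] (pr : Gt →* G)
    (N : Subgroup G) (τ : N →* Gt) (hτ : ∀ n : N, pr (τ n) = (n : G))
    (huniq : ∀ τ' : N →* Gt, (∀ n : N, pr (τ' n) = (n : G)) → τ' = τ)
    (gt : Gt) (hconj : ∀ x ∈ N, pr gt * x * (pr gt)⁻¹ ∈ N) (n : N) :
    τ ⟨pr gt * n * (pr gt)⁻¹, hconj n n.2⟩ = gt * τ n * gt⁻¹ := by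
  let c : N →* N :=
    ((MulAut.conj (pr gt)).toMonoidHom.comp N.subtype).codRestrict N fun x => hconj x x.2
  let τ' : N →* Gt := (MulAut.conj gt⁻¹).toMonoidHom.comp (τ.comp c)
  have hτ' : ∀ m : N, τ' m = gt⁻¹ * τ ⟨pr gt * m * (pr gt)⁻¹, hconj m m.2⟩ * gt := fun m => by
    change gt⁻¹ * τ (c m) * gt⁻¹⁻¹ = _
    rw [inv_inv]
    rfl
  have hτ'_eq : τ' = τ := huniq τ' fun m => by
    rw [hτ']
    simp [hτ, mul_assoc]
  rw [← DFunLike.congr_fun hτ'_eq n, hτ']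
  group

/-- Let `pr : G̃ → G` be a central extension of `G` by a finite group `μ = ker pr`.  Let `N`
be a subgroup of `G` admitting exactly one homomorphic section `τ : N → G̃` of `pr`, let
`N₀ ≤ N` and `N̂₀ = τ(N₀)`.  If `g̃ ∈ G̃`, `g = pr g̃`, and `g` normalizes `N`, then
`g̃ N̂₀ g̃⁻¹ ⊆ N̂₀` if and only if `g N₀ g⁻¹ ⊆ N₀`. -/
theorem conj_lifted_subgroup_iff
    {Gt G : Type*} [Group Gt] [Group G] (pr : Gt →* G)
    (hsurj : Function.Surjective pr) (hker_fin : Finite pr.ker)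
    (hker_cent : pr.ker ≤ Subgroup.center Gt)
    (N : Subgroup G) (τ : N →* Gt)
    (hτ : ∀ n : N, pr (τ n) = (n : G))
    (huniq : ∀ τ' : N →* Gt, (∀ n : N, pr (τ' n) = (n : G)) → τ' = τ)
    (N₀ : Subgroup G) (hN₀ : N₀ ≤ N)
    (gt : Gt) (g : G) (hg : pr gt = g)
    (hnorm : ∀ x : G, g * x * g⁻¹ ∈ N ↔ x ∈ N) :
    (∀ y ∈ (N₀.subgroupOf N).map τ, gt * y * gt⁻¹ ∈ (N₀.subgroupOf N).map τ) ↔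
      (∀ x ∈ N₀, g * x * g⁻¹ ∈ N₀) := by
  subst hg
  have hτ_conj := unique_section_conj pr N τ hτ huniq gt fun x => (hnorm x).2
  constructor
  · intro h x hx
    obtain ⟨m, hm, hmx⟩ := h (τ ⟨x, hN₀ hx⟩) ⟨⟨x, hN₀ hx⟩, hx, rfl⟩
    have hpr : (m : G) = pr gt * x * (pr gt)⁻¹ := by
      rw [← hτ m, hmx]
      simp [hτ]
    exact hpr ▸ hm
  · rintro h _ ⟨n, hn, rfl⟩
    exact ⟨_, h n hn, hτ_conj n⟩
end

section
/- Let V be a vector space over ℚ, regarded as a group under addition, and let M be a finite abelian group regarded as a V-module with trivial action. Then the group cohomology H^n(V, M) vanishes for every integer n ≥ 1. -/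
open CategoryTheory
open scoped Simplicial

/-- A cycle of positive degree in a simplicial abelian group is homologous to an element all of
whose faces vanish. -/
theorem exists_homologous_faces_eq_zero (X : SimplicialObject AddCommGrpCat.{0}) (n : ℕ)
    (x : X _⦋n + 1⦌) (hx : ∑ i : Fin (n + 2), (-1 : ℤ) ^ (i : ℕ) • X.δ i x = 0) :
    ∃ (x' : X _⦋n + 1⦌) (z : X _⦋n + 2⦌), (∀ i, X.δ i x' = 0) ∧
      x = x' + ∑ i : Fin (n + 3), (-1 : ℤ) ^ (i : ℕ) • X.δ i z := by
  let K := AlgebraicTopology.AlternatingFaceMapComplex.obj X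
  have hd (m : ℕ) (y : X _⦋m + 1⦌) : K.d (m + 1) m y =
      ∑ i : Fin (m + 2), (-1 : ℤ) ^ (i : ℕ) • X.δ i y := by
    let ev : (X _⦋m + 1⦌ ⟶ X _⦋m⦌) →+ X _⦋m⦌ := AddMonoidHom.mk' (fun f => f y) fun _ _ => rfl
    change ev (K.d (m + 1) m) = ∑ i : Fin (m + 2), (-1 : ℤ) ^ (i : ℕ) • ev (X.δ i)
    simp [K]
  let P : K ⟶ K := AlgebraicTopology.DoldKan.PInfty
  let h : Homotopy P (𝟙 K) := AlgebraicTopology.DoldKan.homotopyPInftyToId X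
  have hdx : K.d (n + 1) n x = 0 := (hd n x).trans hx
  have hP : P.f (n + 1) x =
      K.d (n + 2) (n + 1) (h.hom (n + 1) (n + 2) x) + (𝟙 K : K ⟶ K).f (n + 1) x := by
    have := ConcreteCategory.congr_hom (h.comm (n + 1)) x
    rw [Homotopy.dNext_succ_chainComplex, Homotopy.prevD_chainComplex] at this
    simpa [hdx] using this
  have hsucc (i : Fin (n + 1)) : X.δ i.succ (P.f (n + 1) x) = 0 :=
    ConcreteCategory.congr_hom (AlgebraicTopology.DoldKan.HigherFacesVanish.of_P (X := X)
      (n + 1) n i (by omega)) x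
  have hdP : K.d (n + 1) n (P.f (n + 1) x) = 0 := by
    have := ConcreteCategory.congr_hom (P.comm (n + 1) n) x
    simp only [ConcreteCategory.comp_apply, hdx, map_zero] at this
    exact this
  refine ⟨P.f (n + 1) x, -(h.hom (n + 1) (n + 2) x), fun i => ?_, ?_⟩
  · refine Fin.cases ?_ hsucc i
    rw [hd, Fin.sum_univ_succ, Finset.sum_eq_zero (fun i _ => by rw [hsucc, smul_zero])] at hdP
    simpa using hdP
  · rw [← hd, map_neg, hP, add_neg_eq_iff_eq_add.2 (add_comm _ _)]
    rfl

/-- In a simplicial commutative ring, if all faces of `x` of positive degree vanish, then every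
power `x ^ p` with `2 ≤ p` is a boundary: up to sign, of `s₀(x) ^ (p - 1) * s₁(x)`. -/
theorem exists_alternating_sum_faces_eq_pow (R : SimplicialObject CommRingCat.{0}) (n p : ℕ)
    (hp : 2 ≤ p) (x : R _⦋n + 1⦌) (hx : ∀ i, R.δ i x = 0) :
    ∃ y : R _⦋n + 2⦌, ∑ i : Fin (n + 3), (-1 : ℤ) ^ (i : ℕ) • R.δ i y = x ^ p := by
  obtain ⟨q, rfl⟩ := Nat.exists_eq_add_of_le' hp
  have comp_apply {m : ℕ} (f : R _⦋n + 1⦌ ⟶ R _⦋n + 2⦌) (g : R _⦋n + 2⦌ ⟶ R _⦋m⦌) :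
      g (f x) = (f ≫ g) x := rfl
  refine ⟨-(R.σ 0 x ^ (q + 1) * R.σ 1 x), ?_⟩
  rw [Fin.sum_univ_succ, Fin.sum_univ_succ, Finset.sum_eq_zero]
  · have h0 : R.δ 0 (R.σ 1 x) = 0 := by
      have := R.δ_comp_σ_of_le (n := n) (i := 0) (j := 0) (by simp)
      rw [comp_apply]
      erw [this]
      simp [hx]
    have h1 : R.δ 1 (R.σ 0 x) = x := by
      have := R.δ_comp_σ_succ (n := n + 1) (i := 0)
      rw [comp_apply]
      erw [this]
      simp
    have h2 : R.δ 1 (R.σ 1 x) = x := by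
      have := R.δ_comp_σ_self (n := n + 1) (i := 1)
      rw [comp_apply]
      erw [this]
      simp
    simp [h0, h1, h2]
    ring
  · intro i _
    have : R.δ i.succ.succ (R.σ 0 x) = 0 := by
      have := R.δ_comp_σ_of_gt (n := n) (i := i.succ) (j := 0) (by simp)
      rw [comp_apply]
      erw [this]
      simp [hx]
    simp [this]

/-- A simplicial commutative ring whose `p`-th power maps are bijective has no homology in
positive degrees. -/
theorem exists_alternating_sum_faces_eq (R : SimplicialObject CommRingCat.{0}) (p : ℕ)
    (hp : 2 ≤ p) (hR : ∀ n, Function.Bijective (fun x : R _⦋n⦌ => x ^ p)) (n : ℕ)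
    (x : R _⦋n + 1⦌) (hx : ∑ i : Fin (n + 2), (-1 : ℤ) ^ (i : ℕ) • R.δ i x = 0) :
    ∃ y : R _⦋n + 2⦌, ∑ i : Fin (n + 3), (-1 : ℤ) ^ (i : ℕ) • R.δ i y = x := by
  obtain ⟨x', z, hx', hz⟩ := exists_homologous_faces_eq_zero
    (R ⋙ forget₂ CommRingCat RingCat ⋙ forget₂ RingCat AddCommGrpCat) n x hx
  obtain ⟨w, rfl⟩ := (hR (n + 1)).2 x'
  obtain ⟨y, hy⟩ := exists_alternating_sum_faces_eq_pow R n p hp w fun i => by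
    refine (hR n).1 ?_
    have : R.δ i (w ^ p) = 0 := hx' i
    simpa [zero_pow (show p ≠ 0 by omega)] using this
  let z' : R _⦋n + 2⦌ := z
  refine ⟨y + z', ?_⟩
  simp only [map_add, smul_add, Finset.sum_add_distrib, hy]
  exact hz.symm

section Bar

variable (G : Type) [CommGroup G]

/-- The map `Gⁿ → Gᵐ` of sets of simplices of the nerve of `G` induced by a map of vertices. -/
def barMap {m n : ℕ} (θ : Fin (m + 1) → Fin (n + 1)) : (Fin n → G) →* (Fin m → G) where
  toFun v k := (Fin.partialProd v (θ k.castSucc))⁻¹ * Fin.partialProd v (θ k.succ)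
  map_one' := by
    have (i : Fin (n + 1)) : Fin.partialProd (1 : Fin n → G) i = 1 :=
      i.inductionOn (by simp) fun i hi => by simp [Fin.partialProd_succ, hi]
    ext; simp [this]
  map_mul' v w := by
    have (i : Fin (n + 1)) :
        Fin.partialProd (v * w) i = Fin.partialProd v i * Fin.partialProd w i :=
      i.inductionOn (by simp) fun i hi => by
        simp [Fin.partialProd_succ, hi, mul_mul_mul_comm]
    ext k
    simp only [this, Pi.mul_apply, mul_inv]
    exact mul_mul_mul_comm _ _ _ _

theorem barMap_apply {m n : ℕ} (θ : Fin (m + 1) → Fin (n + 1)) (v : Fin n → G) (k : Fin m) :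
    barMap G θ v k = (Fin.partialProd v (θ k.castSucc))⁻¹ * Fin.partialProd v (θ k.succ) :=
  rfl

theorem partialProd_barMap {m n : ℕ} (θ : Fin (m + 1) → Fin (n + 1)) (v : Fin n → G)
    (i : Fin (m + 1)) : Fin.partialProd (barMap G θ v) i =
      (Fin.partialProd v (θ 0))⁻¹ * Fin.partialProd v (θ i) :=
  i.inductionOn (by simp) fun i hi => by
    simp [Fin.partialProd_succ, hi, barMap_apply]

theorem barMap_id (n : ℕ) : barMap G (id : Fin (n + 1) → Fin (n + 1)) = MonoidHom.id _ := by
  refine MonoidHom.ext fun v => funext fun k => ?_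
  exact Fin.partialProd_right_inv v k

theorem barMap_comp {l m n : ℕ} (θ : Fin (m + 1) → Fin (n + 1)) (ψ : Fin (l + 1) → Fin (m + 1)) :
    barMap G (θ ∘ ψ) = (barMap G ψ).comp (barMap G θ) := by
  refine MonoidHom.ext fun v => funext fun k => ?_
  simp [barMap_apply, partialProd_barMap]

/-- The simplicial group algebra of the nerve of the commutative group `G`. -/
noncomputable def barRing (k : Type) [CommRing k] : SimplicialObject CommRingCat.{0} where
  obj n := CommRingCat.of (MonoidAlgebra k (Fin n.unop.len → G))
  map θ := CommRingCat.ofHom (MonoidAlgebra.mapDomainRingHom k (barMap G θ.unop.toOrderHom))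
  map_id n := by
    refine CommRingCat.hom_ext ?_
    change MonoidAlgebra.mapDomainRingHom k (barMap G id) = _
    rw [barMap_id, MonoidAlgebra.mapDomainRingHom_id]
    rfl
  map_comp θ ψ := by
    refine CommRingCat.hom_ext ?_
    change MonoidAlgebra.mapDomainRingHom k (barMap G (θ.unop.toOrderHom ∘ ψ.unop.toOrderHom)) = _
    rw [barMap_comp, MonoidAlgebra.mapDomainRingHom_comp]
    rfl

/-- If `a ↦ a ^ p` is bijective on the commutative group `A`, then the Frobenius of `𝔽_p[A]` is
bijective. -/
theorem bijective_pow_monoidAlgebra (p : ℕ) [Fact p.Prime] {A : Type} [CommGroup A]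
    (hA : Function.Bijective (fun a : A => a ^ p)) :
    Function.Bijective (fun x : MonoidAlgebra (ZMod p) A => x ^ p) := by
  have : (fun x : MonoidAlgebra (ZMod p) A => x ^ p) =
      MonoidAlgebra.mapDomain (fun a : A => a ^ p) := by
    funext x
    induction x using MonoidAlgebra.induction_linear with
    | zero => simp [(Fact.out : p.Prime).ne_zero]
    | add f g hf hg =>
      have : CharP (MonoidAlgebra (ZMod p) A) p :=
        charP_of_injective_algebraMap (R := ZMod p) (RingHom.injective _) p
      simp [MonoidAlgebra.mapDomain_add, add_pow_char, ← hf, ← hg]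
    | single a r => simp [MonoidAlgebra.single_pow]
  rw [this]
  refine ⟨MonoidAlgebra.mapDomain_injective hA.1, fun x => ?_⟩
  induction x using MonoidAlgebra.induction_linear with
  | zero => exact ⟨0, MonoidAlgebra.mapDomain_zero _⟩
  | add f g hf hg =>
    obtain ⟨f, rfl⟩ := hf
    obtain ⟨g, rfl⟩ := hg
    exact ⟨f + g, MonoidAlgebra.mapDomain_add _ _ _⟩
  | single a r =>
    obtain ⟨b, rfl⟩ := hA.2 a
    exact ⟨.single b r, by simp⟩

variable {G}

theorem barMap_succAbove_zero {n : ℕ} (v : Fin (n + 1) → G) :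
    barMap G (Fin.succAbove (0 : Fin (n + 2))) v = fun k => v k.succ := by
  funext k
  simpa [barMap_apply] using Fin.partialProd_right_inv v k.succ

theorem barMap_succAbove_succ {n : ℕ} (j : Fin (n + 1)) (v : Fin (n + 1) → G) :
    barMap G j.succ.succAbove v = Fin.contractNth j (· * ·) v := by
  funext k
  rw [← Fin.partialProd_right_inv (Fin.contractNth j (· * ·) v) k, Fin.partialProd_contractNth]
  rfl

/-- The differential of inhomogeneous cochains of `G` with trivial coefficients in `M`,
as the alternating sum of the pullbacks along the face maps of the nerve. -/
def barD {M : Type} [AddCommGroup M] {n : ℕ} (f : (Fin n → G) → M) (v : Fin (n + 1) → G) : M :=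
  ∑ i : Fin (n + 2), (-1 : ℤ) ^ (i : ℕ) • f (barMap G i.succAbove v)

theorem inhomogeneousCochains_d_trivial {M : Type} [AddCommGroup M] {n : ℕ}
    (f : (Fin n → G) → M) :
    inhomogeneousCochains.d (Rep.trivial ℤ G M) n f = barD f := by
  funext v
  rw [inhomogeneousCochains.d_hom_apply, barD, Fin.sum_univ_succ (n := n + 1)]
  simp [← barMap_succAbove_zero, barMap_succAbove_succ]

theorem barD_barD {M : Type} [AddCommGroup M] {n : ℕ} (f : (Fin n → G) → M) :
    barD (barD f) = 0 := by
  rw [← inhomogeneousCochains_d_trivial, ← inhomogeneousCochains_d_trivial]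
  exact ConcreteCategory.congr_hom
    (groupCohomology.inhomogeneousCochains.d_comp_d n (Rep.trivial ℤ G M)) f

theorem barD_comp {M N : Type} [AddCommGroup M] [AddCommGroup N] (φ : M →+ N) {n : ℕ}
    (f : (Fin n → G) → M) : barD (φ ∘ f) = φ ∘ barD f := by
  funext v
  simp [barD]

theorem barD_sub {M : Type} [AddCommGroup M] {n : ℕ} (f g : (Fin n → G) → M) :
    barD (f - g) = barD f - barD g := by
  funext v
  simp [barD, smul_sub]

theorem barD_add {M : Type} [AddCommGroup M] {n : ℕ} (f g : (Fin n → G) → M) :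
    barD (f + g) = barD f + barD g := by
  funext v
  simp [barD, Finset.sum_add_distrib]

/-- Over a field, a linear map vanishing on the kernel of `d` factors through `d`. -/
theorem exists_comp_eq_of_ker_le_ker {k A B M : Type*} [Field k] [AddCommGroup A] [Module k A]
    [AddCommGroup B] [Module k B] [AddCommGroup M] [Module k M] {d : A →ₗ[k] B} {f : A →ₗ[k] M}
    (h : LinearMap.ker d ≤ LinearMap.ker f) : ∃ g : B →ₗ[k] M, g ∘ₗ d = f := by
  obtain ⟨g, hg⟩ := LinearMap.exists_extend
    ((LinearMap.ker d).liftQ f h ∘ₗ d.quotKerEquivRange.symm.toLinearMap)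
  refine ⟨g, LinearMap.ext fun x => ?_⟩
  have hx := LinearMap.congr_fun hg (d.quotKerEquivRange (Submodule.Quotient.mk x))
  simpa using hx

/-- If `g ↦ g ^ p` is bijective on `G`, then every cocycle of positive degree with values in an
`𝔽_p`-vector space is a coboundary. -/
theorem exists_barD_eq_of_zmod_module (p : ℕ) [Fact p.Prime]
    (hG : Function.Bijective (fun g : G => g ^ p)) {M : Type} [AddCommGroup M]
    [Module (ZMod p) M] {n : ℕ} (f : (Fin (n + 1) → G) → M) (hf : barD f = 0) :
    ∃ g : (Fin n → G) → M, barD g = f := by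
  let C (m : ℕ) := MonoidAlgebra (ZMod p) (Fin m → G)
  let D (m : ℕ) : C (m + 1) →ₗ[ZMod p] C m := ∑ i : Fin (m + 2), (-1 : ℤ) ^ (i : ℕ) •
    MonoidAlgebra.mapDomainLinearMap (ZMod p) (ZMod p) (barMap G i.succAbove)
  have hexact (x : C (n + 1)) (hx : D n x = 0) : ∃ y, D (n + 1) y = x := by
    have hD (m : ℕ) (y : C (m + 1)) : D m y =
        ∑ i : Fin (m + 2), (-1 : ℤ) ^ (i : ℕ) • (barRing G (ZMod p)).δ i y := by
      simp only [D, LinearMap.sum_apply, LinearMap.smul_apply]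
      rfl
    obtain ⟨y, hy⟩ := exists_alternating_sum_faces_eq (barRing G (ZMod p)) p
      (Fact.out : p.Prime).two_le (fun m => bijective_pow_monoidAlgebra p (.piMap fun _ => hG))
      n x ((hD n x).symm.trans hx)
    exact ⟨y, (hD (n + 1) y).trans hy⟩
  let L {m : ℕ} (h : (Fin m → G) → M) : C m →ₗ[ZMod p] M :=
    Finsupp.lift M (ZMod p) (Fin m → G) h ∘ₗ (MonoidAlgebra.coeffLinearEquiv (ZMod p)).toLinearMap
  have hL {m : ℕ} (h : (Fin m → G) → M) (v : Fin m → G) (r : ZMod p) :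
      L h (MonoidAlgebra.single v r) = r • h v := by
    have : MonoidAlgebra.coeffLinearEquiv (ZMod p) (MonoidAlgebra.single v r) =
        Finsupp.single v r := rfl
    simp [L, this]
  have hDs {m : ℕ} (F : C m →ₗ[ZMod p] M) (v : Fin (m + 1) → G) (r : ZMod p) :
      F (D m (MonoidAlgebra.single v r)) = r • barD (fun w => F (MonoidAlgebra.single w 1)) v := by
    have hr (w : Fin m → G) : F (MonoidAlgebra.single w r) = r • F (MonoidAlgebra.single w 1) := by
      rw [← map_smul, MonoidAlgebra.smul_single, smul_eq_mul, mul_one]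
    simp only [D, barD, LinearMap.sum_apply, LinearMap.smul_apply, map_sum, map_zsmul,
      Finset.smul_sum]
    refine Finset.sum_congr rfl fun i _ => ?_
    rw [smul_comm r, ← hr]
    exact congrArg _ (congrArg F (MonoidAlgebra.mapDomainLinearMap_single _ _ _))
  have hfD (y : C (n + 2)) : L f (D (n + 1) y) = 0 := by
    induction y using MonoidAlgebra.induction_linear with
    | zero => simp
    | add a b ha hb => rw [map_add, map_add, ha, hb, add_zero]
    | single v r =>
      rw [hDs]
      simp [hL, hf]
  have hker : LinearMap.ker (D n) ≤ LinearMap.ker (L f) := fun x hx => by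
    obtain ⟨y, rfl⟩ := hexact x hx
    exact hfD y
  obtain ⟨g, hg⟩ : ∃ g : C n →ₗ[ZMod p] M, g ∘ₗ D n = L f :=
    exists_comp_eq_of_ker_le_ker hker
  refine ⟨fun w => g (MonoidAlgebra.single w 1), funext fun v => ?_⟩
  have := LinearMap.congr_fun hg (MonoidAlgebra.single v 1)
  simpa [hDs, hL] using this

/-- If `g ↦ g ^ p` is bijective on `G` for all primes `p`, then every cocycle of positive degree
with values in a finite trivial module is a coboundary. -/
theorem exists_barD_eq_of_finite
    (hG : ∀ p : ℕ, p.Prime → Function.Bijective (fun g : G => g ^ p)) (M : Type) [AddCommGroup M]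
    [Finite M] {n : ℕ} (f : (Fin (n + 1) → G) → M) (hf : barD f = 0) :
    ∃ g : (Fin n → G) → M, barD g = f := by
  induction hc : Nat.card M using Nat.strong_induction_on generalizing M with
  | _ c ih =>
  rcases subsingleton_or_nontrivial M with _ | _
  · exact ⟨0, Subsingleton.elim _ _⟩
  obtain ⟨p, hp, hpM⟩ := Nat.exists_prime_and_dvd (Finite.one_lt_card (α := M)).ne'
  have : Fact p.Prime := ⟨hp⟩
  let N : AddSubgroup M := (nsmulAddMonoidHom (α := M) p).range
  have hN : Nat.card N < c := by
    rw [← hc]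
    refine lt_of_le_of_ne (Nat.card_le_card_of_injective _ N.subtype_injective) fun h => ?_
    have htop : N = ⊤ := N.eq_top_of_card_eq h
    have hinj := Finite.injective_iff_surjective.2 (AddMonoidHom.range_eq_top.1 htop)
    obtain ⟨x, hx⟩ := exists_prime_addOrderOf_dvd_card' p hpM
    have hx0 : x = 0 := hinj (by simp [← hx, addOrderOf_nsmul_eq_zero])
    rw [hx0, addOrderOf_zero] at hx
    exact hp.one_lt.ne hx
  let _ : Module (ZMod p) (M ⧸ N) := QuotientAddGroup.zmodModule fun x => ⟨x, rfl⟩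
  obtain ⟨g, hg⟩ := exists_barD_eq_of_zmod_module p (hG p hp) (QuotientAddGroup.mk' N ∘ f)
    (by rw [barD_comp, hf]; funext; simp)
  obtain ⟨g, rfl⟩ := (QuotientAddGroup.mk'_surjective N).comp_left g
  have hmem (v : Fin (n + 1) → G) : (f - barD g) v ∈ N := by
    rw [barD_comp] at hg
    rw [← QuotientAddGroup.eq_zero_iff]
    simpa [sub_eq_zero] using (congrFun hg v).symm
  obtain ⟨h, hh⟩ := ih _ hN N (fun v => ⟨(f - barD g) v, hmem v⟩) (by
    funext v
    refine N.subtype_injective ?_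
    refine (congrFun (barD_comp N.subtype _) v).symm.trans ?_
    change barD (f - barD g) v = 0
    rw [barD_sub, barD_barD, hf]
    simp) rfl
  refine ⟨g + N.subtype ∘ h, ?_⟩
  rw [barD_add, barD_comp, hh]
  funext v
  simp

end Bar

/-- Let `V` be a vector space over `ℚ`, regarded as a group under addition, and let `M` be a
finite abelian group regarded as a trivial `V`-module.  Then the group cohomology `Hⁿ(V, M)`
vanishes for every `n ≥ 1`. -/
theorem groupCohomology_rat_vector_space_finite_coeffs_isZero
    (V : Type) [AddCommGroup V] [Module ℚ V]
    (M : Type) [AddCommGroup M] [Finite M]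
    (n : ℕ) (hn : 1 ≤ n) :
    Limits.IsZero (groupCohomology (Rep.trivial ℤ (Multiplicative V) M) n) := by
  obtain ⟨n, rfl⟩ := Nat.exists_eq_add_of_le' hn
  have hV (p : ℕ) (hp : p.Prime) : Function.Bijective (fun g : Multiplicative V => g ^ p) := by
    have hp0 : (p : ℚ) ≠ 0 := by exact_mod_cast hp.ne_zero
    have : (fun v : V => p • v) = (fun v => (p : ℚ) • v) := by
      funext v; rw [Nat.cast_smul_eq_nsmul]
    change Function.Bijective (fun v : V => p • v)
    rw [this]
    exact (LinearEquiv.smulOfNeZero ℚ V (p : ℚ) hp0).bijective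
  refine (HomologicalComplex.exactAt_iff_isZero_homology _ _).1 ?_
  rw [HomologicalComplex.exactAt_iff' _ n (n + 1) (n + 2) (by simp) (by simp),
    ShortComplex.moduleCat_exact_iff]
  intro (f : (Fin (n + 1) → Multiplicative V) → M) hf
  obtain ⟨g, hg⟩ := exists_barD_eq_of_finite hV M f (by
    rw [← inhomogeneousCochains_d_trivial, ← groupCohomology.inhomogeneousCochains.d_def]
    exact hf)
  refine ⟨g, ?_⟩
  rw [← hg, ← inhomogeneousCochains_d_trivial, ← groupCohomology.inhomogeneousCochains.d_def]
  rfl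
end

section
/- Let p be a prime number and n a positive integer coprime to p. Then for every unit u of the ring ℤ_p of p-adic integers there exist a root of unity ζ ∈ ℤ_p (an element of finite multiplicative order) and a unit v ∈ ℤ_pˣ such that u = ζ · vⁿ. In other words, every coset of the subgroup of n-th powers (ℤ_pˣ)ⁿ in ℤ_pˣ contains a root of unity. -/
open Polynomial in
/-- In a ring that is Henselian along `I`, an approximate `m`-th root which is a unit lifts to
an `m`-th root when `m` is invertible. -/
theorem HenselianRing.exists_pow_eq_of_sub_mem {R : Type*} [CommRing R] {I : Ideal R}
    [HenselianRing R I] {m : ℕ} (hm : IsUnit (m : R)) {a b : R} (ha : IsUnit a)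
    (h : a ^ m - b ∈ I) : ∃ z : R, z ^ m = b ∧ z - a ∈ I := by
  rcases eq_or_ne m 0 with rfl | hm0
  · have : Subsingleton R := subsingleton_of_zero_eq_one (isUnit_zero_iff.mp (by simpa using hm))
    exact ⟨a, Subsingleton.elim _ _, by simp⟩
  · obtain ⟨z, hz, hza⟩ := HenselianRing.is_henselian (I := I) (X ^ m - C b)
      (monic_X_pow_sub_C b hm0) a (by simpa using h)
      (by simpa [derivative_X_pow] using (hm.mul (ha.pow (m - 1))).map (Ideal.Quotient.mk I))
    exact ⟨z, sub_eq_zero.mp (by simpa [IsRoot] using hz), hza⟩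

/-- A natural number coprime to `p` is a unit in `ℤ_[p]`. -/
theorem PadicInt.isUnit_natCast_of_coprime {p : ℕ} [Fact p.Prime] {m : ℕ} (h : m.Coprime p) :
    IsUnit (m : ℤ_[p]) := by
  rw [PadicInt.isUnit_iff]
  exact PadicInt.norm_natCast_eq_one_iff.mpr h.symm

/-- Every unit of `ℤ_[p]` is congruent to a `(p - 1)`-st root of unity. -/
theorem PadicInt.exists_pow_eq_one_sub_mem {p : ℕ} [Fact p.Prime] (u : ℤ_[p]ˣ) :
    ∃ ζ : ℤ_[p], ζ ^ (p - 1) = 1 ∧ ζ - u ∈ IsLocalRing.maximalIdeal ℤ_[p] := by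
  refine HenselianRing.exists_pow_eq_of_sub_mem (isUnit_natCast_of_coprime ?_) u.isUnit ?_
  · have hp := (Fact.out : p.Prime)
    exact (Nat.coprime_of_lt_prime (Nat.sub_ne_zero_of_lt hp.one_lt)
      (Nat.sub_lt hp.pos one_pos) hp).symm
  · rw [← PadicInt.ker_toZMod, RingHom.mem_ker, map_sub, map_pow, map_one,
      ZMod.pow_card_sub_one_eq_one (u.isUnit.map PadicInt.toZMod).ne_zero, sub_self]

/-- Let `p` be a prime and `n` a positive integer coprime to `p`.  Then for every unit `u`
of `ℤ_p` there exist a root of unity `ζ ∈ ℤ_p` (an element of finite multiplicative order)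
and a unit `v ∈ ℤ_pˣ` such that `u = ζ · vⁿ`; i.e. every coset of `(ℤ_pˣ)ⁿ` in `ℤ_pˣ`
contains a root of unity. -/
theorem padicInt_unit_eq_rootOfUnity_mul_nth_power
    (p : ℕ) [Fact p.Prime] (n : ℕ) (hn : 0 < n) (hcop : Nat.Coprime n p) :
    ∀ u : ℤ_[p]ˣ, ∃ ζ : ℤ_[p], (∃ k : ℕ, 0 < k ∧ ζ ^ k = 1) ∧
      ∃ v : ℤ_[p]ˣ, (u : ℤ_[p]) = ζ * (v : ℤ_[p]) ^ n := by
  intro u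
  have hp : 0 < p - 1 := Nat.sub_pos_of_lt (Fact.out : p.Prime).one_lt
  obtain ⟨ζ, hζ, hζu⟩ := PadicInt.exists_pow_eq_one_sub_mem u
  obtain ⟨η, rfl⟩ := IsUnit.of_pow_eq_one hζ hp.ne'
  have hclose : (1 : ℤ_[p]) ^ n - ↑(η⁻¹ * u) ∈ IsLocalRing.maximalIdeal ℤ_[p] := by
    simpa [mul_sub] using Ideal.mul_mem_left _ (↑η⁻¹ : ℤ_[p]) hζu
  obtain ⟨z, hz, -⟩ := HenselianRing.exists_pow_eq_of_sub_mem
    (PadicInt.isUnit_natCast_of_coprime hcop) isUnit_one hclose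
  obtain ⟨v, rfl⟩ : IsUnit z := (isUnit_pow_iff hn.ne').mp (hz ▸ (η⁻¹ * u).isUnit)
  exact ⟨η, ⟨p - 1, hp, hζ⟩, v, by simp [hz]⟩
end
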